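/- arXiv:1510.05914 — 4 statements merged into one kernel-verified Lean document; each statement's English description precedes it below -/
import Mathlib

section
/- The number of exponentially S-numbers up to x equals h·x + O(√x · log x · e^{c√(log x)/log log x}) for the constant c = 4√(2.4/log 2), where h is the density ∏_p (1 + ∑_{i≥2}(u(i)-u(i-1))/p^i), uniformly over all sets S of positive integers containing 1. -/
def IsExpSNumber (S : Set ℕ) (N : ℕ) : Prop :=
  0 < N ∧ ∀ p : ℕ, p.Prime → p ∣ N → N.factorization p ∈ S

open Finset in
lemma aux_powerful (n : ℕ) (hn : n ≠ 0) (h : ∀ p, n.factorization p ≠ 1) :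
    ∃ a b : ℕ, n = (a + 1) ^ 2 * (b + 1) ^ 3 := by
  obtain ⟨a, b, hab, hsq⟩ := Nat.sq_mul_squarefree n
  have ha : a ≠ 0 := by rintro rfl; simp at hab; exact hn hab.symm
  have hb : b ≠ 0 := by rintro rfl; simp at hab; exact hn hab.symm
  have hd : a ∣ b := by
    rw [← Nat.factorization_le_iff_dvd ha hb]
    intro p
    have h1 := hsq.natFactorization_le_one p
    have h2 := h p
    rw [← hab, Nat.factorization_mul (pow_ne_zero _ hb) ha, Nat.factorization_pow] at h2
    simp at h2
    omega
  obtain ⟨c, rfl⟩ := hd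
  have hc : c ≠ 0 := by rintro rfl; simp at hb
  refine ⟨c - 1, a - 1, ?_⟩
  rw [Nat.sub_add_cancel (Nat.pos_of_ne_zero hc), Nat.sub_add_cancel (Nat.pos_of_ne_zero ha), ← hab]
  ring

lemma aux_term (s : ℝ) (hs : 0 < s) (n : ℕ) :
    min 1 (s ^ 2 / ((n : ℝ) + 1) ^ 2) ≤ 4 * s ^ 2 * (1 / (s + n) - 1 / (s + (n + 1 : ℕ))) := by
  have hn : (0 : ℝ) ≤ n := Nat.cast_nonneg n
  have e : 4 * s ^ 2 * (1 / (s + n) - 1 / (s + (n + 1 : ℕ)))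
      = 4 * s ^ 2 / ((s + n) * (s + n + 1)) := by
    push_cast
    field_simp
    ring
  rw [e, le_div_iff₀ (by positivity)]
  rcases le_total s ((n : ℝ) + 1) with h | h
  · calc _ ≤ s ^ 2 / ((n : ℝ) + 1) ^ 2 * ((s + n) * (s + n + 1)) := by
          gcongr; exact min_le_right _ _
      _ ≤ s ^ 2 / ((n : ℝ) + 1) ^ 2 * (4 * ((n : ℝ) + 1) ^ 2) := by
          refine mul_le_mul_of_nonneg_left ?_ (by positivity)
          nlinarith
      _ = 4 * s ^ 2 := by field_simp
  · calc _ ≤ 1 * ((s + n) * (s + n + 1)) := by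
          gcongr; exact min_le_left _ _
      _ ≤ 4 * s ^ 2 := by nlinarith

lemma aux_sum_a (s : ℝ) (hs : 0 < s) (N : ℕ) :
    ∑ n ∈ Finset.range N, min 1 (s ^ 2 / ((n : ℝ) + 1) ^ 2) ≤ 4 * s := by
  calc _ ≤ ∑ n ∈ Finset.range N, 4 * s ^ 2 * (1 / (s + n) - 1 / (s + (n + 1 : ℕ))) :=
        Finset.sum_le_sum fun n _ => aux_term s hs n
    _ = 4 * s ^ 2 * (1 / (s + (0 : ℕ)) - 1 / (s + N)) := by
        rw [← Finset.mul_sum, Finset.sum_range_sub' (fun n : ℕ => 1 / (s + (n : ℝ)))]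
    _ ≤ 4 * s ^ 2 * (1 / s) := by
        gcongr
        have : 0 ≤ 1 / (s + N) := by positivity
        simp at *; linarith
    _ = 4 * s := by field_simp

lemma aux_sum_ab : ∃ K : ℝ, 0 < K ∧ ∀ (x : ℝ), 0 < x → ∀ N : ℕ,
    ∑ b ∈ Finset.range N, ∑ a ∈ Finset.range N,
      min 1 (x / (((a : ℝ) + 1) ^ 2 * ((b : ℝ) + 1) ^ 3)) ≤ K * √x := by
  have hsum : Summable (fun b : ℕ => 1 / ((b : ℝ) + 1) ^ (3 / 2 : ℝ)) := by
    have := (Real.summable_one_div_nat_rpow (p := 3 / 2)).2 (by norm_num)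
    have := (summable_nat_add_iff 1).2 this
    simpa using this
  refine ⟨4 * (∑' b : ℕ, 1 / ((b : ℝ) + 1) ^ (3 / 2 : ℝ)) + 1, ?_, ?_⟩
  · have : 0 ≤ ∑' b : ℕ, 1 / ((b : ℝ) + 1) ^ (3 / 2 : ℝ) := tsum_nonneg fun b => by positivity
    linarith
  intro x hx N
  have key : ∀ b : ℕ, ∑ a ∈ Finset.range N,
      min 1 (x / (((a : ℝ) + 1) ^ 2 * ((b : ℝ) + 1) ^ 3)) ≤
      4 * √x * (1 / ((b : ℝ) + 1) ^ (3 / 2 : ℝ)) := by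
    intro b
    have hb : (0 : ℝ) < (b : ℝ) + 1 := by positivity
    have hs : (√x / ((b : ℝ) + 1) ^ (3 / 2 : ℝ)) ^ 2 = x / ((b : ℝ) + 1) ^ 3 := by
      rw [div_pow, Real.sq_sqrt hx.le, ← Real.rpow_natCast (_ ^ (3 / 2 : ℝ)), ← Real.rpow_mul hb.le]
      norm_num
    have := aux_sum_a (√x / ((b : ℝ) + 1) ^ (3 / 2 : ℝ))
      (div_pos (Real.sqrt_pos.2 hx) (by positivity)) N
    rw [hs] at this
    calc _ = ∑ n ∈ Finset.range N, min 1 (x / ((b : ℝ) + 1) ^ 3 / ((n : ℝ) + 1) ^ 2) := by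
          refine Finset.sum_congr rfl fun a _ => ?_
          rw [div_div, mul_comm]
      _ ≤ _ := this
      _ = _ := by ring
  calc _ ≤ ∑ b ∈ Finset.range N, 4 * √x * (1 / ((b : ℝ) + 1) ^ (3 / 2 : ℝ)) :=
        Finset.sum_le_sum fun b _ => key b
    _ = 4 * √x * ∑ b ∈ Finset.range N, (1 / ((b : ℝ) + 1) ^ (3 / 2 : ℝ)) := by
        rw [Finset.mul_sum]
    _ ≤ 4 * √x * ∑' b : ℕ, (1 / ((b : ℝ) + 1) ^ (3 / 2 : ℝ)) := by
        gcongr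
        exact hsum.sum_le_tsum _ fun b _ => by positivity
    _ ≤ _ := by nlinarith [Real.sqrt_nonneg x]

open Classical in
lemma aux_sum_d : ∃ K : ℝ, 0 < K ∧ ∀ g : ℕ → ℝ, g 0 = 0 → (∀ n, |g n| ≤ 1) →
    (∀ n, g n ≠ 0 → ∀ p, n.factorization p ≠ 1) →
    ∀ x : ℝ, 0 < x → ∀ N : ℕ, ∑ d ∈ Finset.range N, |g d| * min 1 (x / d) ≤ K * √x := by
  obtain ⟨K, hK, H⟩ := aux_sum_ab
  refine ⟨K, hK, fun g g0 g1 g2 x hx N => ?_⟩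
  have hex : ∀ n, ∃ ab : ℕ × ℕ, g n ≠ 0 → n = (ab.1 + 1) ^ 2 * (ab.2 + 1) ^ 3 := by
    intro n
    by_cases h : g n = 0
    · exact ⟨(0, 0), fun h' => absurd h h'⟩
    · obtain ⟨a, b, hab⟩ := aux_powerful n (by rintro rfl; exact h g0) (g2 n h)
      exact ⟨(a, b), fun _ => hab⟩
  choose φ hφ using hex
  calc _ = ∑ d ∈ (Finset.range N).filter (fun d => g d ≠ 0), |g d| * min 1 (x / d) := by
        rw [Finset.sum_filter]
        refine Finset.sum_congr rfl fun d _ => ?_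
        split_ifs with h
        · rfl
        · simp at h; simp [h]
    _ ≤ ∑ d ∈ (Finset.range N).filter (fun d => g d ≠ 0),
          min 1 (x / ((((φ d).1 : ℝ) + 1) ^ 2 * (((φ d).2 : ℝ) + 1) ^ 3)) := by
        refine Finset.sum_le_sum fun d hd => ?_
        have h := hφ d (Finset.mem_filter.1 hd).2
        have h' : (d : ℝ) = (((φ d).1 : ℝ) + 1) ^ 2 * (((φ d).2 : ℝ) + 1) ^ 3 := by
          exact_mod_cast h
        rw [← h']
        exact mul_le_of_le_one_left (le_min zero_le_one (by positivity)) (g1 d)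
    _ = ∑ ab ∈ ((Finset.range N).filter (fun d => g d ≠ 0)).image φ,
          min 1 (x / (((ab.1 : ℝ) + 1) ^ 2 * ((ab.2 : ℝ) + 1) ^ 3)) := by
        rw [Finset.sum_image]
        intro d hd e he hde
        rw [hφ d (Finset.mem_filter.1 hd).2, hφ e (Finset.mem_filter.1 he).2, hde]
    _ ≤ ∑ ab ∈ Finset.range N ×ˢ Finset.range N,
          min 1 (x / (((ab.1 : ℝ) + 1) ^ 2 * ((ab.2 : ℝ) + 1) ^ 3)) := by
        refine Finset.sum_le_sum_of_subset_of_nonneg ?_ fun ab _ _ =>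
          le_min zero_le_one (by positivity)
        intro ab hab
        obtain ⟨d, hd, rfl⟩ := Finset.mem_image.1 hab
        have h := hφ d (Finset.mem_filter.1 hd).2
        have hN := Finset.mem_range.1 (Finset.mem_filter.1 hd).1
        have h1 : (φ d).1 + 1 ≤ d := by
          conv_rhs => rw [h]
          exact (Nat.le_self_pow two_ne_zero _).trans (Nat.le_mul_of_pos_right _ (by positivity))
        have h2 : (φ d).2 + 1 ≤ d := by
          conv_rhs => rw [h]
          exact (Nat.le_self_pow three_ne_zero _).trans (Nat.le_mul_of_pos_left _ (by positivity))
        simp only [Finset.mem_product, Finset.mem_range]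
        omega
    _ = _ := by rw [Finset.sum_product_right]
    _ ≤ _ := H x hx N

noncomputable def mulOf (w : ℕ → ℝ) : ArithmeticFunction ℝ :=
  ⟨fun n => if n = 0 then 0 else n.factorization.prod fun _ k => w k, by simp⟩

lemma mulOf_apply (w : ℕ → ℝ) {n : ℕ} (hn : n ≠ 0) :
    mulOf w n = n.factorization.prod fun _ k => w k := by
  simp [mulOf, hn]

lemma mulOf_mult (w : ℕ → ℝ) : (mulOf w).IsMultiplicative := by
  rw [ArithmeticFunction.IsMultiplicative.iff_ne_zero]
  refine ⟨by simp [mulOf], fun {m n} hm hn h => ?_⟩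
  rw [mulOf_apply w hm, mulOf_apply w hn, mulOf_apply w (mul_ne_zero hm hn),
    Nat.factorization_mul_of_coprime h, Finsupp.prod_add_index_of_disjoint]
  exact h.disjoint_primeFactors

lemma mulOf_prime_pow (w : ℕ → ℝ) (h0 : w 0 = 1) {p : ℕ} (hp : p.Prime) (k : ℕ) :
    mulOf w (p ^ k) = w k := by
  rw [mulOf_apply w (pow_ne_zero _ hp.ne_zero), hp.factorization_pow,
    Finsupp.prod_single_index h0]

lemma mulOf_zeta (v w : ℕ → ℝ) (hv0 : v 0 = 1) (hw0 : w 0 = 1)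
    (h : ∀ k, w (k + 1) = v (k + 1) - v k) :
    mulOf w * (ArithmeticFunction.zeta : ArithmeticFunction ℝ) = mulOf v := by
  rw [ArithmeticFunction.IsMultiplicative.eq_iff_eq_on_prime_powers _
    ((mulOf_mult w).mul ArithmeticFunction.isMultiplicative_zeta.natCast) _ (mulOf_mult v)]
  intro p k hp
  rw [ArithmeticFunction.coe_mul_zeta_apply, Nat.sum_divisors_prime_pow hp,
    mulOf_prime_pow v hv0 hp]
  simp_rw [mulOf_prime_pow w hw0 hp]
  rw [Finset.sum_range_succ']
  simp_rw [h]
  rw [Finset.sum_range_sub, hv0, hw0]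
  ring

lemma main_bound : ∃ K : ℝ, 0 < K ∧ ∀ S : Set ℕ, 1 ∈ S →
      ∀ u : ℕ → ℝ, (∀ i, u i = Set.indicator S (fun _ => (1 : ℝ)) i) →
        ∀ x : ℕ, 0 < x →
          |({n : ℕ | IsExpSNumber S n ∧ n ≤ x}.ncard : ℝ) -
            (∏' p : Nat.Primes,
              (1 + ∑' i : ℕ, (u (i + 2) - u (i + 1)) / (p : ℝ) ^ (i + 2))) * x|
          ≤ K * √x := by
  classical
  obtain ⟨K, hK, H⟩ := aux_sum_d
  refine ⟨K, hK, fun S hS u hu x hx => ?_⟩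
  have hu' : ∀ i, u i = if i ∈ S then 1 else 0 := fun i => by
    rw [hu, Set.indicator_apply]
  let v : ℕ → ℝ := fun k => if k = 0 then 1 else u k
  let w : ℕ → ℝ := fun k => if k = 0 then 1 else v k - v (k - 1)
  have hv0 : v 0 = 1 := rfl
  have hw0 : w 0 = 1 := rfl
  have hw : ∀ k, w (k + 1) = v (k + 1) - v k := fun k => by simp [w]
  have hw1 : w 1 = 0 := by simp [w, v, hu', hS]
  have hwle : ∀ k, |w k| ≤ 1 := by
    intro k
    simp only [w, v, hu']
    split_ifs <;> norm_num
  have hz := mulOf_zeta v w hv0 hw0 hw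
  set g := mulOf w with hg
  have g1 : ∀ n, |g n| ≤ 1 := by
    intro n
    by_cases hn : n = 0
    · simp [hn]
    · rw [hg, mulOf_apply w hn, Finsupp.prod, Finset.abs_prod]
      exact Finset.prod_le_one (fun _ _ => abs_nonneg _) fun _ _ => hwle _
  have g2 : ∀ n, g n ≠ 0 → ∀ p, n.factorization p ≠ 1 := by
    intro n hgn p hp
    have hn : n ≠ 0 := by rintro rfl; simp at hgn
    apply hgn
    rw [hg, mulOf_apply w hn, Finsupp.prod]
    refine Finset.prod_eq_zero (i := p) ?_ (by rw [hp, hw1])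
    simp [Finsupp.mem_support_iff, -Nat.support_factorization, hp]
  have B := H (fun n => g n) (by simp) g1 g2
  have hs : Summable fun d : ℕ => |g d| / d := by
    have : (fun d : ℕ => |g d| / d) = fun d : ℕ => |g d| * min 1 ((1 : ℝ) / d) := by
      funext d
      by_cases hd : d = 0
      · simp [hd]
      · have : (1 : ℝ) ≤ d := by exact_mod_cast Nat.pos_of_ne_zero hd
        rw [min_eq_right ((div_le_one (by positivity)).2 this)]
        ring
    rw [this]
    exact summable_of_sum_range_le (fun d => mul_nonneg (abs_nonneg _)
      (le_min zero_le_one (by positivity))) (B 1 one_pos)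
  have hs' : Summable fun d : ℕ => g d / d := by
    refine Summable.of_norm ?_
    simpa [abs_div] using hs
  -- Euler product
  have hprod : ∏' p : Nat.Primes,
      (1 + ∑' i : ℕ, (u (i + 2) - u (i + 1)) / (p : ℝ) ^ (i + 2)) = ∑' d : ℕ, g d / d := by
    have hE := EulerProduct.eulerProduct_hasProd (f := fun d : ℕ => g d / (d : ℝ))
      (by simp [(mulOf_mult w).1, hg])
      (by
        intro m n hmn
        simp only [hg, (mulOf_mult w).2 hmn]
        push_cast
        rw [mul_div_mul_comm]) hs'.norm (by simp)
    rw [← hE.tprod_eq]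
    refine tprod_congr fun p => ?_
    have hps : Summable fun e : ℕ => g ((p : ℕ) ^ e) / (((p : ℕ) ^ e : ℕ) : ℝ) :=
      hs'.comp_injective (Nat.pow_right_injective p.2.two_le)
    rw [← hps.sum_add_tsum_nat_add 2]
    simp only [hg, mulOf_prime_pow w hw0 p.2, Finset.sum_range_succ, Finset.sum_range_zero, hw0, hw1]
    simp [w, v]
  rw [hprod]
  -- counting
  have hcount : ({n : ℕ | IsExpSNumber S n ∧ n ≤ x}.ncard : ℝ)
      = ∑ d ∈ Finset.Ioc 0 x, g d * ((x / d : ℕ) : ℝ) := by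
    rw [← ArithmeticFunction.sum_Ioc_mul_zeta_eq_sum, hz]
    have : {n : ℕ | IsExpSNumber S n ∧ n ≤ x}
        = ((Finset.Ioc 0 x).filter (IsExpSNumber S) : Finset ℕ) := by
      ext n
      simp [IsExpSNumber]
      tauto
    rw [this, Set.ncard_coe_finset, Finset.card_filter]
    push_cast
    refine Finset.sum_congr rfl fun n hn => ?_
    have hn0 : n ≠ 0 := (Finset.mem_Ioc.1 hn).1.ne'
    rw [mulOf_apply v hn0, Finsupp.prod]
    have hvv : ∀ p ∈ n.factorization.support, v (n.factorization p)
        = if n.factorization p ∈ S then 1 else 0 := by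
      intro p hp
      simp only [v, hu', Finsupp.mem_support_iff.1 hp, if_false]
    rw [Finset.prod_congr rfl hvv, Finset.prod_ite_zero]
    simp only [Finset.prod_const_one]
    refine if_congr ?_ rfl rfl
    simp [IsExpSNumber, Nat.pos_of_ne_zero hn0, hn0]
  have hcount2 : ({n : ℕ | IsExpSNumber S n ∧ n ≤ x}.ncard : ℝ)
      = ∑' d : ℕ, g d * ((x / d : ℕ) : ℝ) := by
    rw [hcount, tsum_eq_sum]
    intro d hd
    rcases Nat.eq_zero_or_pos d with rfl | h
    · simp
    · have : x < d := by simp at hd; exact hd h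
      simp [Nat.div_eq_of_lt this]
  have hsf : Summable fun d : ℕ => g d * ((x / d : ℕ) : ℝ) := by
    refine summable_of_ne_finset_zero (s := Finset.Ioc 0 x) ?_
    intro d hd
    rcases Nat.eq_zero_or_pos d with rfl | h
    · simp
    · have : x < d := by simp at hd; exact hd h
      simp [Nat.div_eq_of_lt this]
  have hxs := hs'.mul_right (x : ℝ)
  rw [hcount2, ← tsum_mul_right, ← hsf.tsum_sub hxs]
  have hterm : ∀ d : ℕ, |g d * ((x / d : ℕ) : ℝ) - g d / d * x| ≤ |g d| * min 1 ((x : ℝ) / d) := by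
    intro d
    have : g d * ((x / d : ℕ) : ℝ) - g d / d * x = g d * (((x / d : ℕ) : ℝ) - x / d) := by ring
    rw [this, abs_mul]
    refine mul_le_mul_of_nonneg_left ?_ (abs_nonneg _)
    have h1 : ((x / d : ℕ) : ℝ) ≤ (x : ℝ) / d := Nat.cast_div_le
    have h0 : (0 : ℝ) ≤ ((x / d : ℕ) : ℝ) := Nat.cast_nonneg _
    have h2 : (x : ℝ) / d ≤ ((x / d : ℕ) : ℝ) + 1 := by
      rw [← Nat.floor_div_eq_div (K := ℝ)]
      exact (Nat.lt_floor_add_one _).le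
    rw [abs_sub_comm, abs_of_nonneg (by linarith)]
    exact le_min (by linarith) (by linarith)
  have hx' : (0 : ℝ) < x := by exact_mod_cast hx
  have hnn : ∀ d : ℕ, 0 ≤ |g d| * min 1 ((x : ℝ) / d) := fun d =>
    mul_nonneg (abs_nonneg _) (le_min zero_le_one (by positivity))
  have hsb : Summable fun d : ℕ => |g d| * min 1 ((x : ℝ) / d) :=
    summable_of_sum_range_le hnn (B x hx')
  rw [← Real.norm_eq_abs]
  exact (tsum_of_norm_bounded hsb.hasSum hterm).trans
    (Real.tsum_le_of_sum_range_le hnn (B x hx'))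

theorem stmt_10 :
    ∃ C : ℝ, 0 < C ∧ ∀ S : Set ℕ, 1 ∈ S →
      ∀ u : ℕ → ℝ, (∀ i, u i = Set.indicator S (fun _ => (1 : ℝ)) i) →
        ∀ x : ℕ, 16 ≤ x →
          |({n : ℕ | IsExpSNumber S n ∧ n ≤ x}.ncard : ℝ) -
            (∏' p : Nat.Primes,
              (1 + ∑' i : ℕ, (u (i + 2) - u (i + 1)) / (p : ℝ) ^ (i + 2))) * x|
          ≤ C * Real.sqrt x * Real.log x *
              Real.exp ((4 * Real.sqrt (2.4 / Real.log 2)) *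
                Real.sqrt (Real.log x) / Real.log (Real.log x)) := by
  obtain ⟨K, hK, H⟩ := main_bound
  refine ⟨K, hK, fun S hS u hu x hx => (H S hS u hu x (by omega)).trans ?_⟩
  have hx' : (16 : ℝ) ≤ x := by exact_mod_cast hx
  have hl : 1 ≤ Real.log x := by
    rw [Real.le_log_iff_exp_le (by linarith)]
    linarith [Real.exp_one_lt_d9]
  have hll : 0 ≤ Real.log (Real.log x) := Real.log_nonneg hl
  have he : 1 ≤ Real.exp ((4 * Real.sqrt (2.4 / Real.log 2)) *
                Real.sqrt (Real.log x) / Real.log (Real.log x)) :=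
    Real.one_le_exp (by positivity)
  have h0 : 0 ≤ K * √(x : ℝ) := by positivity
  calc K * √(x : ℝ) = K * √(x : ℝ) * 1 * 1 := by ring
    _ ≤ _ := by gcongr
end

section
/- For a squarefree number r, the count b_r(x) of squarefree numbers n ≤ x with gcd(n, r) = 1 satisfies b_r(x) = (6/π²)·(∏_{p|r} p/(p+1))·x + O_r(√x). -/
open ArithmeticFunction (moebius LSeries_zeta_mul_Lseries_moebius LSeries_zeta_eq_riemannZeta LSeriesSummable_moebius_iff coe_mul_zeta_apply moebius_mul_coe_zeta one_apply abs_moebius_le_one)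

lemma moeb_hasSum : HasSum (fun d : ℕ => (moebius d : ℝ) / (d:ℝ)^2) (6 / Real.pi ^ 2) := by
  have h2 : (1:ℝ) < (2:ℂ).re := by norm_num
  have h := LSeries_zeta_mul_Lseries_moebius h2
  rw [LSeries_zeta_eq_riemannZeta h2, riemannZeta_two] at h
  have hs : LSeriesSummable _ 2 := LSeriesSummable_moebius_iff.2 h2
  have hh := hs.LSeriesHasSum
  rw [LSeriesHasSum] at hh
  have e : LSeries (fun n => ((moebius n : ℤ) : ℂ)) 2 = ((6 / Real.pi ^ 2 : ℝ) : ℂ) := by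
    have : (Real.pi : ℂ) ≠ 0 := by exact_mod_cast Real.pi_ne_zero
    push_cast
    field_simp
    field_simp at h
    linear_combination h
  rw [e] at hh
  rw [← Complex.hasSum_ofReal]
  convert hh using 1
  ext n
  rw [LSeries.term_def]
  split_ifs with hn
  · simp [hn]
  · push_cast
    norm_cast

lemma sqf_sum (n N : ℕ) (hn : 0 < n) (hN : n < (N+1)^2) :
    ∑ d ∈ Finset.Ioc 0 N, (if d ^ 2 ∣ n then (moebius d : ℤ) else 0) = if Squarefree n then 1 else 0 := by
  obtain ⟨a, b, ha, hb, hab, hsq⟩ := Nat.sq_mul_squarefree_of_pos hn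
  have h1 : (Finset.Ioc 0 N).filter (fun d => d ^ 2 ∣ n) = b.divisors := by
    ext d
    simp only [Finset.mem_filter, Finset.mem_Ioc, Nat.mem_divisors]
    constructor
    · rintro ⟨_, h⟩
      refine ⟨?_, hb.ne'⟩
      rw [← hab] at h
      have hd0 : d ≠ 0 := by omega
      rw [← Nat.factorization_le_iff_dvd (by positivity) (by positivity)] at h
      rw [← Nat.factorization_le_iff_dvd hd0 hb.ne']
      intro p
      have h4 := h p
      have h5 := hsq.natFactorization_le_one p
      rw [Nat.factorization_mul (by positivity) ha.ne'] at h4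
      simp at h4
      omega
    · rintro ⟨h, _⟩
      have h3 : d ^ 2 ∣ n := hab ▸ (pow_dvd_pow_of_dvd h 2).mul_right a
      refine ⟨⟨Nat.pos_of_dvd_of_pos h hb, ?_⟩, h3⟩
      have := (Nat.le_of_dvd hn h3).trans_lt hN
      have := lt_of_pow_lt_pow_left₀ 2 (by omega) this
      omega
  rw [← Finset.sum_filter, h1, ← coe_mul_zeta_apply, moebius_mul_coe_zeta, one_apply]
  have : b = 1 ↔ Squarefree n := by
    constructor
    · rintro rfl; rw [← hab]; simpa using hsq
    · intro h
      exact Nat.isUnit_iff.1 (h b ⟨a, by rw [← hab]; ring⟩)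
  simp [this]

lemma tail (N : ℕ) : |(6 / Real.pi ^ 2 : ℝ) - ∑ d ∈ Finset.Ioc 0 N, (moebius d : ℝ) / (d:ℝ)^2| ≤ 2 / ((N:ℝ) + 1) := by
  have h := moeb_hasSum.tendsto_sum_nat
  refine le_of_tendsto ((h.sub_const _).abs) ?_
  filter_upwards [Filter.eventually_gt_atTop N] with n hn
  have : ∑ i ∈ Finset.range n, (moebius i : ℝ) / (i:ℝ)^2 - ∑ d ∈ Finset.Ioc 0 N, (moebius d : ℝ) / (d:ℝ)^2
     = ∑ d ∈ Finset.Ioo N n, (moebius d : ℝ) / (d:ℝ)^2 := by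
    rw [sub_eq_iff_eq_add', Finset.range_eq_Ico, Finset.sum_eq_sum_Ico_succ_bot (by omega)]
    rw [← Finset.sum_union]
    · have h0 : (moebius 0 : ℝ) / ((0:ℕ):ℝ)^2 = 0 := by simp
      rw [h0, zero_add]
      refine Finset.sum_congr ?_ fun _ _ => rfl
      ext i; simp; omega
    · rw [Finset.disjoint_left]; intro i; simp; omega
  rw [this]
  refine (Finset.abs_sum_le_sum_abs _ _).trans (le_trans (Finset.sum_le_sum ?_) (sum_Ioo_inv_sq_le N n))
  intro i _
  rw [abs_div, abs_of_nonneg (by positivity : (0:ℝ) ≤ (i:ℝ)^2), div_eq_mul_inv]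
  have : |(moebius i : ℝ)| ≤ 1 := by exact_mod_cast abs_moebius_le_one (n := i)
  exact mul_le_of_le_one_left (by positivity) this

lemma base (x : ℝ) (hx : 0 ≤ x) :
    |((({n ∈ Finset.Ioc 0 ⌊x⌋₊ | Squarefree n} : Finset ℕ).card) : ℝ) - 6 / Real.pi ^ 2 * x| ≤ 3 * √x := by
  set N := ⌊√x⌋₊
  have hN1 : (N:ℝ) ≤ √x := Nat.floor_le (Real.sqrt_nonneg x)
  have hN2 : √x < N + 1 := Nat.lt_floor_add_one _
  have hxx := Real.sq_sqrt hx
  have hs0 := Real.sqrt_nonneg x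
  have e : ((({n ∈ Finset.Ioc 0 ⌊x⌋₊ | Squarefree n} : Finset ℕ).card) : ℤ) =
      ∑ d ∈ Finset.Ioc 0 N, (moebius d : ℤ) * (⌊x⌋₊ / d ^ 2 : ℕ) := by
    rw [Finset.card_filter]
    push_cast
    have : ∀ n ∈ Finset.Ioc 0 ⌊x⌋₊, (if Squarefree n then (1:ℤ) else 0) =
        ∑ d ∈ Finset.Ioc 0 N, (if d ^ 2 ∣ n then (moebius d : ℤ) else 0) := by
      intro n hn
      rw [Finset.mem_Ioc] at hn
      rw [sqf_sum n N hn.1]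
      have h1 : (n:ℝ) ≤ x := (Nat.le_floor_iff hx).1 hn.2
      have : (n:ℝ) < ((N:ℝ)+1)^2 := by nlinarith
      exact_mod_cast this
    rw [Finset.sum_congr rfl this, Finset.sum_comm]
    refine Finset.sum_congr rfl fun d _ => ?_
    rw [← Finset.sum_filter, Finset.sum_const, Nat.Ioc_filter_dvd_card_eq_div]
    simp [mul_comm]
  have e' : ((({n ∈ Finset.Ioc 0 ⌊x⌋₊ | Squarefree n} : Finset ℕ).card) : ℝ) =
      ∑ d ∈ Finset.Ioc 0 N, (moebius d : ℝ) * (⌊x⌋₊ / d ^ 2 : ℕ) := by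
    have := congrArg (Int.cast (R := ℝ)) e
    rw [Int.cast_sum] at this
    simpa only [Int.cast_mul, Int.cast_natCast] using this
  rw [e']
  have h1 : |∑ d ∈ Finset.Ioc 0 N, (moebius d : ℝ) * (⌊x⌋₊ / d ^ 2 : ℕ) -
      (∑ d ∈ Finset.Ioc 0 N, (moebius d : ℝ) / (d:ℝ)^2) * x| ≤ N := by
    rw [Finset.sum_mul, ← Finset.sum_sub_distrib]
    refine (Finset.abs_sum_le_sum_abs _ _).trans ?_
    refine (Finset.sum_le_sum (g := fun _ => (1:ℝ)) ?_).trans (by simp)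
    intro d _
    have : (moebius d : ℝ) * (⌊x⌋₊ / d ^ 2 : ℕ) - (moebius d : ℝ) / (d:ℝ)^2 * x
        = (moebius d : ℝ) * ((⌊x / (d^2 : ℕ)⌋₊ : ℝ) - x / (d^2 : ℕ)) := by
      rw [Nat.floor_div_natCast]; push_cast; ring
    rw [this, abs_mul]
    have h3 : |(moebius d : ℝ)| ≤ 1 := by exact_mod_cast abs_moebius_le_one (n := d)
    refine mul_le_one₀ h3 (abs_nonneg _) ?_
    have h4 : 0 ≤ x / (d^2 : ℕ) := by positivity
    have := Nat.floor_le h4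
    have := Nat.lt_floor_add_one (x / (d^2 : ℕ))
    rw [abs_le]; constructor <;> linarith
  have h2 := tail N
  have h3 : |6 / Real.pi ^ 2 * x - (∑ d ∈ Finset.Ioc 0 N, (moebius d : ℝ) / (d:ℝ)^2) * x| ≤ 2 * √x := by
    rw [← sub_mul, abs_mul, abs_of_nonneg hx]
    refine (mul_le_mul_of_nonneg_right h2 hx).trans ?_
    rw [div_mul_eq_mul_div, div_le_iff₀ (by positivity)]
    nlinarith
  rw [abs_le] at *
  constructor <;> linarith

def QS (s : Finset ℕ) (x : ℝ) : Set ℕ := {n : ℕ | Squarefree n ∧ (∀ p ∈ s, ¬ p ∣ n) ∧ (n : ℝ) ≤ x}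

lemma QS_finite (s : Finset ℕ) (x : ℝ) : (QS s x).Finite := by
  apply (Set.finite_Iic ⌊x⌋₊).subset
  rintro n ⟨_, _, h⟩
  exact Nat.le_floor h

lemma QS_step (s : Finset ℕ) (p : ℕ) (hp : p.Prime) (hs : ∀ q ∈ s, q.Prime) (hps : p ∉ s) (x : ℝ) :
    (QS s x).ncard = (QS (insert p s) x).ncard + (QS (insert p s) (x / p)).ncard := by
  have hp0 : (0:ℝ) < p := by exact_mod_cast hp.pos
  have h : QS s x = QS (insert p s) x ∪ (fun n => p * n) '' QS (insert p s) (x / p) := by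
    ext n
    simp only [QS, Set.mem_union, Set.mem_image, Set.mem_ofPred_eq, Finset.mem_insert, forall_eq_or_imp]
    constructor
    · rintro ⟨h1, h2, h3⟩
      by_cases hpn : p ∣ n
      · right
        obtain ⟨m, rfl⟩ := hpn
        obtain ⟨hc, -, hm⟩ := Nat.squarefree_mul_iff.1 h1
        refine ⟨m, ⟨hm, ⟨(hp.coprime_iff_not_dvd).1 hc, fun q hq hqm => h2 q hq (hqm.mul_left p)⟩, ?_⟩, rfl⟩
        rw [le_div_iff₀ hp0]
        push_cast at h3
        linarith
      · left
        exact ⟨h1, ⟨hpn, h2⟩, h3⟩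
    · rintro (⟨h1, ⟨_, h2⟩, h3⟩ | ⟨m, ⟨h1, ⟨h4, h2⟩, h3⟩, rfl⟩)
      · exact ⟨h1, h2, h3⟩
      · refine ⟨Nat.squarefree_mul_iff.2 ⟨(hp.coprime_iff_not_dvd).2 h4, hp.prime.squarefree, h1⟩, ?_, ?_⟩
        · intro q hq hd
          rcases (hs q hq).dvd_mul.1 hd with h | h
          · rw [(Nat.prime_dvd_prime_iff_eq (hs q hq) hp).1 h] at hq
            exact hps hq
          · exact h2 q hq h
        · rw [le_div_iff₀ hp0] at h3
          push_cast
          linarith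
  rw [h, Set.ncard_union_eq _ (QS_finite _ _) ((QS_finite _ _).image _),
    Set.ncard_image_of_injective _ (fun a b h => Nat.eq_of_mul_eq_mul_left hp.pos h)]
  rw [Set.disjoint_left]
  rintro n ⟨_, h2, _⟩ ⟨m, _, rfl⟩
  exact h2 p (Finset.mem_insert_self _ _) (Dvd.intro _ rfl)

lemma QS_ind (s : Finset ℕ) (hs : ∀ q ∈ s, q.Prime) (c : ℝ)
    (h0 : ∃ C : ℝ, 0 < C ∧ ∀ x : ℝ, 0 ≤ x → |((QS ∅ x).ncard : ℝ) - c * x| ≤ C * √x) :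
    ∃ C : ℝ, 0 < C ∧ ∀ x : ℝ, 0 ≤ x →
      |((QS s x).ncard : ℝ) - c * (∏ p ∈ s, (p : ℝ) / (p + 1)) * x| ≤ C * √x := by
  induction s using Finset.induction_on with
  | empty => simpa using h0
  | insert p s hps ih =>
    have hs' : ∀ q ∈ s, q.Prime := fun q hq => hs q (Finset.mem_insert_of_mem hq)
    have hp : p.Prime := hs p (Finset.mem_insert_self _ _)
    obtain ⟨C, hC, ih⟩ := ih hs'
    rw [Finset.prod_insert hps]
    set P := ∏ p ∈ s, (p : ℝ) / (p + 1) with hP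
    have hp2 : (2:ℝ) ≤ p := by exact_mod_cast hp.two_le
    set c' := c * (p / (p + 1) * P) with hc'
    refine ⟨4 * C + |c'|, by positivity, ?_⟩
    have key : ∀ N : ℕ, ∀ x : ℝ, 0 ≤ x → x < N →
        |((QS (insert p s) x).ncard : ℝ) - c' * x| ≤ (4 * C + |c'|) * √x := by
      intro N
      induction N with
      | zero => intro x h1 h2; simp at h2; linarith
      | succ N ihN =>
        intro x hx hxN
        by_cases hx1 : x < 1
        · have : QS (insert p s) x = ∅ := by
            ext n
            simp only [QS, Set.mem_ofPred_eq, Set.mem_empty_iff_false, iff_false]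
            rintro ⟨h1, _, h3⟩
            have : (1:ℝ) ≤ n := by exact_mod_cast Nat.pos_of_ne_zero h1.ne_zero
            linarith
          rw [this]
          simp only [Set.ncard_empty, Nat.cast_zero, zero_sub, abs_neg, abs_mul, abs_of_nonneg hx]
          have h1 : x ≤ √x := Real.le_sqrt_of_sq_le (by nlinarith)
          have := Real.sqrt_nonneg x
          nlinarith [abs_nonneg c', mul_le_mul_of_nonneg_left h1 (abs_nonneg c')]
        · push Not at hx1
          push_cast at hxN
          have hN : (1:ℝ) ≤ N := by
            have : (0:ℝ) < N := by linarith
            exact_mod_cast this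
          have hxp : x / p ≤ x / 2 := by gcongr
          have h1 := ihN (x / p) (by positivity) (by linarith)
          have h2 := ih x hx
          rw [QS_step s p hp hs' hps x] at h2
          push_cast at h2
          have h3 : c * P * x = c' * x + c' * (x / p) := by
            rw [hc']; field_simp
          have h4 : √(x / p) ≤ 3 / 4 * √x := by
            rw [Real.sqrt_le_iff]
            refine ⟨by positivity, ?_⟩
            rw [mul_pow, Real.sq_sqrt hx]; linarith
          have h5 : (4 * C + |c'|) * √(x / p) ≤ (4 * C + |c'|) * (3 / 4 * √x) := by gcongr
          have h6 : 0 ≤ |c'| * √x := by positivity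
          rw [h3] at h2
          rw [abs_le] at *
          constructor <;> linarith
    intro x hx
    exact key (⌊x⌋₊ + 1) x hx (by exact_mod_cast Nat.lt_floor_add_one x)

theorem stmt_11 (r : ℕ) (hr : Squarefree r) :
    ∃ C : ℝ, 0 < C ∧ ∀ x : ℝ, 1 ≤ x →
      |({n : ℕ | Squarefree n ∧ Nat.Coprime n r ∧ (n : ℝ) ≤ x}.ncard : ℝ) -
        (6 / Real.pi ^ 2) * (∏ p ∈ r.primeFactors, (p : ℝ) / ((p : ℝ) + 1)) * x|
      ≤ C * Real.sqrt x := by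
  obtain ⟨C, hC, h⟩ := QS_ind r.primeFactors (fun q hq => Nat.prime_of_mem_primeFactors hq)
    (6 / Real.pi ^ 2) ⟨3, by norm_num, fun x hx => by
      have h := base x hx
      have e : QS ∅ x = (({n ∈ Finset.Ioc 0 ⌊x⌋₊ | Squarefree n} : Finset ℕ) : Set ℕ) := by
        ext n
        simp only [QS, Set.mem_ofPred_eq, Finset.coe_filter, Finset.mem_Ioc, Nat.le_floor_iff hx]
        constructor
        · rintro ⟨h1, _, h3⟩
          exact ⟨⟨Nat.pos_of_ne_zero h1.ne_zero, h3⟩, h1⟩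
        · rintro ⟨⟨_, h3⟩, h1⟩
          exact ⟨h1, by simp, h3⟩
      rw [e, Set.ncard_coe_finset]
      exact h⟩
  refine ⟨C, hC, fun x hx => ?_⟩
  have e : {n : ℕ | Squarefree n ∧ Nat.Coprime n r ∧ (n : ℝ) ≤ x} = QS r.primeFactors x := by
    ext n
    simp only [QS, Set.mem_ofPred_eq]
    have : Nat.Coprime n r ↔ ∀ p ∈ r.primeFactors, ¬ p ∣ n := by
      constructor
      · intro hc p hp hpn
        have hp' := Nat.prime_of_mem_primeFactors hp
        exact Nat.not_coprime_of_dvd_of_dvd hp'.one_lt hpn (Nat.dvd_of_mem_primeFactors hp) hc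
      · intro hp
        refine Nat.Coprime.symm (Nat.coprime_of_dvd fun p hpp hpr hpn => ?_)
        exact hp p (Nat.mem_primeFactors.2 ⟨hpp, hpr, hr.ne_zero⟩) hpn
    rw [this]
  rw [e]
  exact h x (by linarith)
end

section
/- The number of powerful numbers up to x is (ζ(3/2)/ζ(3))·x^{1/2} + (ζ(2/3)/ζ(2))·x^{1/3} + O(x^{1/6}). -/
def IsPowerful (n : ℕ) : Prop :=
  0 < n ∧ ∀ p : ℕ, p.Prime → p ∣ n → p ^ 2 ∣ n

section Aux
open Filter Topology


noncomputable def zh (n : ℕ) (s : ℂ) : ℂ :=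
  (s - 1) * (((n:ℝ) + 1 : ℝ) : ℂ) ^ (-s) + ((((n:ℝ) + 1) + 1 : ℝ) : ℂ) ^ (1 - s) - (((n:ℝ) + 1 : ℝ) : ℂ) ^ (1 - s)

lemma zh_bound (a : ℝ) (ha : 0 < a) (s : ℂ) (hs : 0 < s.re) :
    ‖(s - 1) * (a : ℂ) ^ (-s) + ((a + 1 : ℝ) : ℂ) ^ (1 - s) - (a : ℂ) ^ (1 - s)‖ ≤
      ‖1 - s‖ * (‖s‖ * a ^ (-s.re - 1)) := by
  by_cases h1 : s = 1
  · subst h1; simp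
  have h1' : 1 - s ≠ 0 := fun h => h1 (sub_eq_zero.mp h).symm
  have hs0 : -s ≠ 0 := by
    intro h
    have : s = 0 := neg_eq_zero.mp h
    rw [this] at hs; simp at hs
  have m1 : ∀ t ∈ Set.Icc a (a+1), ‖(t:ℂ) ^ (-s) - (a:ℂ) ^ (-s)‖ ≤ ‖s‖ * a ^ (-s.re - 1) := by
    intro t ht
    have := norm_image_sub_le_of_norm_deriv_le_segment' (f := fun y : ℝ => (y:ℂ) ^ (-s)) (a := a) (b := a + 1)
      (f' := fun y => (-s) * (y:ℂ) ^ (-s - 1)) (C := ‖s‖ * a ^ (-s.re - 1))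
      (fun x hx => (hasDerivAt_ofReal_cpow_const (lt_of_lt_of_le ha hx.1).ne' hs0).hasDerivWithinAt)
      (fun x hx => ?_) t ht
    · refine this.trans ?_
      have : 0 ≤ ‖s‖ * a ^ (-s.re - 1) := by positivity
      nlinarith [ht.2, ht.1]
    · have hx0 : 0 < x := lt_of_lt_of_le ha hx.1
      rw [norm_mul, norm_neg, Complex.norm_cpow_eq_rpow_re_of_pos hx0]
      gcongr
      simp only [Complex.sub_re, Complex.neg_re, Complex.one_re]
      exact Real.rpow_le_rpow_of_nonpos ha hx.1 (by linarith)
  have := norm_image_sub_le_of_norm_deriv_le_segment' (f := fun y : ℝ => (y:ℂ) ^ (1-s) - (1 - s) * (a:ℂ) ^ (-s) * (y:ℂ)) (a := a) (b := a + 1)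
      (f' := fun y => (1-s) * (y:ℂ) ^ (1 - s - 1) - (1 - s) * (a:ℂ) ^ (-s) * ((1:ℝ):ℂ)) (C := ‖1-s‖ * (‖s‖ * a ^ (-s.re - 1)))
      (fun x hx => ?_)
      (fun x hx => ?_) (a+1) ⟨by linarith, le_rfl⟩
  · refine le_trans (le_of_eq ?_) (this.trans (by simp))
    congr 1
    push_cast
    ring
  · have hx0 : 0 < x := lt_of_lt_of_le ha hx.1
    refine HasDerivAt.hasDerivWithinAt ?_
    exact (hasDerivAt_ofReal_cpow_const hx0.ne' h1').sub ((hasDerivAt_id x).ofReal_comp.const_mul _)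
  · have hx0 : 0 < x := lt_of_lt_of_le ha hx.1
    have e : (1-s) * (x:ℂ) ^ (1 - s - 1) - (1 - s) * (a:ℂ) ^ (-s) * ((1:ℝ):ℂ) = (1 - s) * ((x:ℂ)^(-s) - (a:ℂ)^(-s)) := by
      have : 1 - s - 1 = -s := by ring
      rw [this]; push_cast; ring
    rw [e, norm_mul]
    gcongr
    exact m1 x ⟨hx.1, hx.2.le⟩

lemma zh_sum (N : ℕ) (s : ℂ) : ∑ n ∈ Finset.range N, zh n s =
    (s - 1) * ∑ n ∈ Finset.range N, (((n:ℝ) + 1 : ℝ) : ℂ) ^ (-s) + (((N:ℝ) + 1 : ℝ) : ℂ) ^ (1 - s) - 1 := by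
  induction N with
  | zero => simp
  | succ k ih =>
    rw [Finset.sum_range_succ, Finset.sum_range_succ, ih, zh]
    push_cast
    ring

def zU : Set ℂ := {s : ℂ | 1/2 < s.re} ∩ Metric.ball 0 4

lemma zU_open : IsOpen zU :=
  (isOpen_lt continuous_const Complex.continuous_re).inter Metric.isOpen_ball

lemma zU_conv : Convex ℝ zU :=
  (convex_halfSpace_re_gt _).inter (convex_ball _ _)

lemma zh_le (n : ℕ) (s : ℂ) (hs : s ∈ zU) : ‖zh n s‖ ≤ 20 * ((n:ℝ)+1) ^ (-(3/2) : ℝ) := by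
  obtain ⟨h1, h2⟩ := hs
  have h1 : 1/2 < s.re := h1
  have h2 : ‖s‖ < 4 := by simpa using h2
  refine (zh_bound ((n:ℝ)+1) (by positivity) s (by linarith)).trans ?_
  have h3 : ‖1 - s‖ ≤ 5 := (norm_sub_le _ _).trans (by simp; linarith)
  have h4 : ((n:ℝ)+1) ^ (-s.re - 1) ≤ ((n:ℝ)+1) ^ (-(3/2) : ℝ) := by
    apply Real.rpow_le_rpow_of_exponent_le
    · have : (0:ℝ) ≤ n := by positivity
      linarith
    · linarith
  calc _ ≤ 5 * (4 * ((n:ℝ)+1) ^ (-(3/2) : ℝ)) := by gcongr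
    _ = _ := by ring

lemma zh_summable : Summable (fun n : ℕ => 20 * ((n:ℝ)+1) ^ (-(3/2) : ℝ)) := by
  apply Summable.mul_left
  have := (Real.summable_one_div_nat_add_rpow 1 (3/2)).2 (by norm_num)
  refine this.congr fun n => ?_
  rw [abs_of_pos (by positivity), Real.rpow_neg (by positivity), one_div]

lemma z_tail (s : ℂ) (hs : 1 < s.re) : Tendsto (fun N : ℕ => (((N:ℝ) + 1 : ℝ) : ℂ) ^ (1 - s)) atTop (𝓝 0) := by
  rw [tendsto_zero_iff_norm_tendsto_zero]
  have e : ∀ N : ℕ, ‖(((N:ℝ) + 1 : ℝ) : ℂ) ^ (1 - s)‖ = ((N:ℝ)+1) ^ (-(s.re - 1)) := by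
    intro N
    rw [Complex.norm_cpow_eq_rpow_re_of_pos (by positivity)]
    simp
  simp_rw [e]
  exact (tendsto_rpow_neg_atTop (by linarith : 0 < s.re - 1)).comp
    (tendsto_atTop_add_const_right _ _ tendsto_natCast_atTop_atTop)

lemma z_eq_gt (s : ℂ) (hs : 1 < s.re) (hU : s ∈ zU) : riemannZeta₁ s = 1 + ∑' n, zh n s := by
  have hs1 : s ≠ 1 := by rintro rfl; simp at hs
  have hsum : Summable (fun n => zh n s) := Summable.of_norm_bounded zh_summable (fun n => zh_le n s hU)
  have t1 := hsum.hasSum.tendsto_sum_nat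
  have hz : Summable (fun n : ℕ => (((n:ℝ) + 1 : ℝ) : ℂ) ^ (-s)) := by
    have := (Complex.summable_one_div_nat_cpow (p := s)).2 hs
    rw [← summable_nat_add_iff 1] at this
    refine this.congr fun n => ?_
    rw [Complex.cpow_neg]; push_cast; simp
  have hz2 : ∑' n : ℕ, (((n:ℝ) + 1 : ℝ) : ℂ) ^ (-s) = riemannZeta s := by
    rw [zeta_eq_tsum_one_div_nat_add_one_cpow hs]
    congr 1; ext n; rw [Complex.cpow_neg]; push_cast; simp
  have t2 := ((hz.hasSum.tendsto_sum_nat.const_mul (s-1)).add (z_tail s hs)).sub_const 1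
  simp_rw [zh_sum] at t1
  have := tendsto_nhds_unique t1 t2
  rw [this, hz2, riemannZeta_eq_inv_sub_mul hs1]
  have : s - 1 ≠ 0 := sub_ne_zero.mpr hs1
  field_simp
  ring

lemma z_eq (s : ℂ) (hU : s ∈ zU) : riemannZeta₁ s = 1 + ∑' n, zh n s := by
  have hd : DifferentiableOn ℂ (fun s => 1 + ∑' n, zh n s) zU := by
    apply DifferentiableOn.const_add
    apply Complex.differentiableOn_tsum_of_summable_norm zh_summable _ zU_open
    · intro n w hw; exact zh_le n w hw
    · intro n
      have hp : (((n:ℝ) + 1 : ℝ) : ℂ) ≠ 0 := by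
        norm_cast
      have hp2 : (((n:ℝ) + 1 + 1 : ℝ) : ℂ) ≠ 0 := by
        norm_cast
      apply Differentiable.differentiableOn
      intro w
      unfold zh
      refine DifferentiableAt.sub (DifferentiableAt.add (DifferentiableAt.mul (by fun_prop) ?_) ?_) ?_
      · exact (by fun_prop : DifferentiableAt ℂ (fun s : ℂ => -s) w).const_cpow (Or.inl hp)
      · exact (by fun_prop : DifferentiableAt ℂ (fun s : ℂ => 1 - s) w).const_cpow (Or.inl hp2)
      · exact (by fun_prop : DifferentiableAt ℂ (fun s : ℂ => 1 - s) w).const_cpow (Or.inl hp)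
  have h2 : (2:ℂ) ∈ zU := by
    constructor
    · simp; norm_num
    · simp; norm_num
  have key := AnalyticOnNhd.eqOn_of_preconnected_of_eventuallyEq (𝕜 := ℂ)
    (f := riemannZeta₁) (g := fun s => 1 + ∑' n, zh n s) (U := zU)
    (differentiable_riemannZeta₁.differentiableOn.analyticOnNhd zU_open)
    (hd.analyticOnNhd zU_open) zU_conv.isPreconnected h2 ?_
  · exact key hU
  · have o : IsOpen (zU ∩ {s : ℂ | 1 < s.re}) := zU_open.inter (isOpen_lt continuous_const Complex.continuous_re)
    filter_upwards [o.mem_nhds ⟨h2, by simp⟩] with w hw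
    exact z_eq_gt w hw.2 hw.1

/-- real version -/
lemma z_tendsto (s : ℝ) (h1 : 1/2 < s) (h2 : s < 4) (h3 : s ≠ 1) :
    Tendsto (fun N : ℕ => ∑ n ∈ Finset.range N, ((n:ℝ) + 1) ^ (-s) - ((N:ℝ) + 1) ^ (1 - s) / (1 - s)) atTop
      (𝓝 (riemannZeta (s:ℂ)).re) := by
  have hU : (s:ℂ) ∈ zU := by
    constructor
    · simpa using h1
    · simp [abs_of_pos (by linarith : 0 < s), h2]
  have hs1 : (s:ℂ) ≠ 1 := by exact_mod_cast h3
  have hsum : Summable (fun n => zh n s) := Summable.of_norm_bounded zh_summable (fun n => zh_le n s hU)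
  have t1 := (hsum.hasSum.tendsto_sum_nat.const_add 1).const_mul ((s:ℂ)-1)⁻¹
  rw [← z_eq _ hU, ← riemannZeta_eq_inv_sub_mul hs1] at t1
  have t2 := (Complex.continuous_re.tendsto _).comp t1
  refine t2.congr fun N => ?_
  simp only [Function.comp]
  rw [zh_sum]
  have e : ((s:ℂ)-1)⁻¹ * (1 + (((s:ℂ) - 1) * ∑ n ∈ Finset.range N, (((n:ℝ) + 1 : ℝ) : ℂ) ^ (-(s:ℂ)) + (((N:ℝ) + 1 : ℝ) : ℂ) ^ (1 - (s:ℂ)) - 1)) =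
    ((∑ n ∈ Finset.range N, ((n:ℝ) + 1) ^ (-s) - ((N:ℝ) + 1) ^ (1 - s) / (1 - s) : ℝ) : ℂ) := by
    have n1 : (s:ℂ) - 1 ≠ 0 := sub_ne_zero.mpr hs1
    have n2 : (1:ℂ) - s ≠ 0 := fun h => hs1 (sub_eq_zero.mp h).symm
    rw [Complex.ofReal_sub, Complex.ofReal_div, Complex.ofReal_sum, Complex.ofReal_cpow (by positivity)]
    simp_rw [fun n : ℕ => Complex.ofReal_cpow (by positivity : 0 ≤ (n:ℝ)+1) (-s)]
    push_cast
    field_simp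
    ring
  rw [e, Complex.ofReal_re]

lemma em_tangent (s t u : ℝ) (hs : 0 < s) (ht : 0 < t) (hu : 0 < u) :
    t ^ (-s) - s * t ^ (-s - 1) * (u - t) ≤ u ^ (-s) := by
  have hr : 0 < u / t := by positivity
  have h1 : 1 - s * (u / t - 1) ≤ (u / t) ^ (-s) := by
    rw [Real.rpow_def_of_pos hr]
    have := Real.log_le_sub_one_of_pos hr
    have := Real.add_one_le_exp (Real.log (u/t) * -s)
    nlinarith
  have h2 : u ^ (-s) = t ^ (-s) * (u / t) ^ (-s) := by
    rw [← Real.mul_rpow ht.le hr.le]; congr 1; field_simp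
  have h3 : t ^ (-s - 1) = t ^ (-s) / t := by rw [Real.rpow_sub_one ht.ne']
  rw [h2, h3]
  have hp : 0 < t ^ (-s) := by positivity
  calc _ = t ^ (-s) * (1 - s * (u / t - 1)) := by field_simp
    _ ≤ _ := by gcongr

lemma em_deriv (s : ℝ) (h3 : s ≠ 1) (t : ℝ) (ht : 0 < t) :
    HasDerivAt (fun t : ℝ => t ^ (1 - s) / (1 - s)) (t ^ (-s)) t := by
  have h : 1 - s ≠ 0 := fun h => h3 (by linarith)
  have := (Real.hasDerivAt_rpow_const (x := t) (p := 1 - s) (Or.inl ht.ne')).div_const (1 - s)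
  refine this.congr_deriv ?_
  rw [show 1 - s - 1 = -s by ring]
  field_simp

lemma em_lower (s a : ℝ) (hs : 0 < s) (h3 : s ≠ 1) (ha : 0 < a) :
    a ^ (-s) - s * a ^ (-s - 1) / 2 ≤ (a + 1) ^ (1 - s) / (1 - s) - a ^ (1 - s) / (1 - s) := by
  have key : MonotoneOn (fun t : ℝ => t ^ (1 - s) / (1 - s) - a ^ (-s) * (t - a) + s * a ^ (-s-1) / 2 * (t - a) ^ 2) (Set.Icc a (a+1)) := by
    have hd : ∀ t ∈ Set.Icc a (a+1), HasDerivAt (fun t : ℝ => t ^ (1 - s) / (1 - s) - a ^ (-s) * (t - a) + s * a ^ (-s-1) / 2 * (t - a) ^ 2)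
       (t ^ (-s) - a ^ (-s) + s * a ^ (-s-1) * (t - a)) t := by
      intro t ht
      have ht0 : 0 < t := lt_of_lt_of_le ha ht.1
      have e1 : HasDerivAt (fun t : ℝ => t - a) 1 t := (hasDerivAt_id t).sub_const a
      refine (((em_deriv s h3 t ht0).sub (e1.const_mul (a ^ (-s)))).add ((e1.pow 2).const_mul (s * a ^ (-s-1) / 2))).congr_deriv ?_
      simp; ring
    apply monotoneOn_of_hasDerivWithinAt_nonneg (convex_Icc _ _)
      (f' := fun t => t ^ (-s) - a ^ (-s) + s * a ^ (-s-1) * (t - a))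
    · exact fun t ht => (hd t ht).continuousAt.continuousWithinAt
    · intro t ht; exact (hd t (interior_subset ht)).hasDerivWithinAt
    · intro t ht
      have ht := interior_subset ht
      have := em_tangent s a t hs ha (lt_of_lt_of_le ha ht.1)
      linarith
  have := key (Set.left_mem_Icc.2 (by linarith)) (Set.right_mem_Icc.2 (by linarith)) (by linarith : a ≤ a + 1)
  simp at this
  linarith

lemma em_upper (s a : ℝ) (hs : 0 < s) (h3 : s ≠ 1) (ha : 0 < a) :
    (a + 1) ^ (1 - s) / (1 - s) - a ^ (1 - s) / (1 - s) ≤ (a ^ (-s) + (a + 1) ^ (-s)) / 2 := by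
  have key : MonotoneOn (fun t : ℝ => (a ^ (-s) + t ^ (-s)) * (t - a) / 2 - t ^ (1 - s) / (1 - s)) (Set.Icc a (a+1)) := by
    have hd : ∀ t ∈ Set.Icc a (a+1), HasDerivAt (fun t : ℝ => (a ^ (-s) + t ^ (-s)) * (t - a) / 2 - t ^ (1 - s) / (1 - s))
       ((a ^ (-s) - t ^ (-s) + (- s) * t ^ (-s-1) * (t - a)) / 2) t := by
      intro t ht
      have ht0 : 0 < t := lt_of_lt_of_le ha ht.1
      have e1 : HasDerivAt (fun t : ℝ => t - a) 1 t := (hasDerivAt_id t).sub_const a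
      have e2 := ((Real.hasDerivAt_rpow_const (x := t) (p := - s) (Or.inl ht0.ne')).const_add (a ^ (-s)))
      refine (((e2.mul e1).div_const 2).sub (em_deriv s h3 t ht0)).congr_deriv ?_
      ring
    apply monotoneOn_of_hasDerivWithinAt_nonneg (convex_Icc _ _)
      (f' := fun t => (a ^ (-s) - t ^ (-s) + (- s) * t ^ (-s-1) * (t - a)) / 2)
    · exact fun t ht => (hd t ht).continuousAt.continuousWithinAt
    · intro t ht; exact (hd t (interior_subset ht)).hasDerivWithinAt
    · intro t ht
      have ht := interior_subset ht
      have := em_tangent s t a hs (lt_of_lt_of_le ha ht.1) ha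
      linarith
  have := key (Set.left_mem_Icc.2 (by linarith)) (Set.right_mem_Icc.2 (by linarith)) (by linarith : a ≤ a + 1)
  simp at this
  linarith

lemma em_main (s : ℝ) (h1 : 1/2 < s) (h2 : s < 4) (h3 : s ≠ 1) (N : ℕ) (hN : 1 ≤ N) :
    |∑ n ∈ Finset.range N, ((n:ℝ) + 1) ^ (-s) - (N:ℝ) ^ (1 - s) / (1 - s) - (N:ℝ) ^ (-s) / 2
      - (riemannZeta (s:ℂ)).re| ≤ s / 2 * (N:ℝ) ^ (-s - 1) := by
  have hs : 0 < s := by linarith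
  set U : ℕ → ℝ := fun N => ∑ n ∈ Finset.range N, ((n:ℝ) + 1) ^ (-s) - ((N:ℝ) + 1) ^ (1 - s) / (1 - s) + ((N:ℝ) + 1) ^ (-s) / 2 with hU
  set V : ℕ → ℝ := fun N => U N + s / 2 * ((N:ℝ) + 1) ^ (-s - 1) with hV
  have tp : ∀ p : ℝ, 0 < p → Tendsto (fun N : ℕ => ((N:ℝ)+1) ^ (-p)) atTop (𝓝 0) := fun p hp =>
    (tendsto_rpow_neg_atTop hp).comp (tendsto_atTop_add_const_right _ _ tendsto_natCast_atTop_atTop)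
  have tU : Tendsto U atTop (𝓝 (riemannZeta (s:ℂ)).re) := by
    simpa using (z_tendsto s h1 h2 h3).add ((tp s hs).div_const 2)
  have tV : Tendsto V atTop (𝓝 (riemannZeta (s:ℂ)).re) := by
    have := tU.add ((tp (s+1) (by linarith)).const_mul (s/2))
    rw [show -(s+1) = -s-1 by ring] at this
    simpa using this
  have mU : Monotone U := by
    apply monotone_nat_of_le_succ
    intro n
    have := em_upper s ((n:ℝ)+1) hs h3 (by positivity)
    simp only [hU, Finset.sum_range_succ]
    push_cast
    linarith
  have mV : Antitone V := by
    apply antitone_nat_of_succ_le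
    intro n
    have h4 := em_lower s ((n:ℝ)+1) hs h3 (by positivity)
    have h5 := em_tangent s ((n:ℝ)+1+1) ((n:ℝ)+1) hs (by positivity) (by positivity)
    simp only [hV, hU, Finset.sum_range_succ]
    push_cast
    nlinarith
  obtain ⟨k, rfl⟩ : ∃ k, N = k + 1 := ⟨N - 1, by omega⟩
  have a1 := mU.ge_of_tendsto tU k
  have a2 := mV.le_of_tendsto tV k
  simp only [hV, hU] at a1 a2
  rw [Finset.sum_range_succ]
  push_cast
  rw [abs_le]
  constructor <;> linarith

noncomputable def psi (t : ℝ) : ℝ := Int.fract t - 1/2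

lemma psi_abs (t : ℝ) : |psi t| ≤ 1/2 := by
  unfold psi
  rw [abs_le]
  constructor <;> linarith [Int.fract_nonneg t, (Int.fract_lt_one t).le]

lemma fract_div (z : ℤ) (q : ℕ) (hq : 0 < q) (u : ℝ) (hu0 : 0 ≤ u) (hu1 : u < 1) :
    Int.fract (((z:ℝ) + u) / q) = (((z % (q:ℤ)) : ℤ) + u) / q := by
  have hq' : (0:ℝ) < q := by exact_mod_cast hq
  rw [Int.fract_eq_iff]
  have h0 : 0 ≤ z % (q:ℤ) := Int.emod_nonneg _ (by omega)
  have h1 : z % (q:ℤ) + 1 ≤ q := Int.emod_lt_of_pos _ (by omega)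
  have h0' : (0:ℝ) ≤ ((z % (q:ℤ) : ℤ) : ℝ) := by exact_mod_cast h0
  have h1' : ((z % (q:ℤ) : ℤ) : ℝ) + 1 ≤ q := by exact_mod_cast h1
  refine ⟨by positivity, ?_, z / (q:ℤ), ?_⟩
  · rw [div_lt_one hq']; linarith
  · have h := Int.emod_add_mul_ediv z (q:ℤ)
    have h' : ((z % (q:ℤ) : ℤ) : ℝ) + (q:ℝ) * ((z / (q:ℤ) : ℤ):ℝ) = z := by exact_mod_cast h
    rw [← h']
    field_simp
    ring

lemma res_sum (q : ℕ) (hq : 0 < q) (a : ℤ) (hc : IsCoprime a (q:ℤ)) (β : ℝ) :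
    |∑ h ∈ Finset.range q, psi (β + a * h / q)| ≤ 1/2 := by
  have hq' : (0:ℝ) < q := by exact_mod_cast hq
  set m : ℤ := ⌊β * q⌋
  set u : ℝ := Int.fract (β * q)
  have hmu : β * q = m + u := (Int.floor_add_fract _).symm
  have hu0 : 0 ≤ u := Int.fract_nonneg _
  have hu1 : u < 1 := Int.fract_lt_one _
  have e1 : ∀ h : ℕ, Int.fract (β + a * h / q) = ((((m + a * h) % (q:ℤ)).toNat : ℝ) + u) / q := by
    intro h
    have : β + a * h / q = (((m + a * h : ℤ) : ℝ) + u) / q := by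
      push_cast
      field_simp
      linarith
    rw [this, fract_div _ q hq u hu0 hu1]
    have h0 : 0 ≤ (m + a * h) % (q:ℤ) := Int.emod_nonneg _ (by omega)
    congr 2
    have := Int.toNat_of_nonneg h0
    exact_mod_cast this.symm
  have e2 : ∑ h ∈ Finset.range q, Int.fract (β + a * h / q) = ∑ j ∈ Finset.range q, ((j:ℝ) + u) / q := by
    have inj : Set.InjOn (fun h : ℕ => ((m + a * h) % (q:ℤ)).toNat) (Finset.range q : Set ℕ) := by
      intro x hx y hy hxy
      simp only [Finset.coe_range, Set.mem_Iio] at hx hy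
      have hx0 : 0 ≤ (m + a * x) % (q:ℤ) := Int.emod_nonneg _ (by omega)
      have hy0 : 0 ≤ (m + a * y) % (q:ℤ) := Int.emod_nonneg _ (by omega)
      have hxy : ((m + a * x) % (q:ℤ)).toNat = ((m + a * y) % (q:ℤ)).toNat := hxy
      have h1 : (m + a * x) % (q:ℤ) = (m + a * y) % (q:ℤ) := by omega
      have h2 : (q:ℤ) ∣ a * (x - y) := by
        have := Int.ModEq.dvd (show m + a * y ≡ m + a * x [ZMOD q] from h1.symm)
        rwa [show m + a * x - (m + a * y) = a * (x - y) by ring] at this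
      have h3 : (q:ℤ) ∣ (x:ℤ) - y := hc.symm.dvd_of_dvd_mul_left h2
      have h4 := Int.eq_zero_of_abs_lt_dvd h3 (by rw [abs_lt]; constructor <;> omega)
      omega
    have im : (Finset.range q).image (fun h : ℕ => ((m + a * h) % (q:ℤ)).toNat) = Finset.range q := by
      apply Finset.eq_of_subset_of_card_le
      · intro j hj
        simp only [Finset.mem_image, Finset.mem_range] at hj ⊢
        obtain ⟨h, _, rfl⟩ := hj
        have hx0 : 0 ≤ (m + a * h) % (q:ℤ) := Int.emod_nonneg _ (by omega)
        have hx1 : (m + a * h) % (q:ℤ) < q := Int.emod_lt_of_pos _ (by omega)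
        omega
      · rw [Finset.card_image_of_injOn inj]
    have e4 := Finset.sum_image (f := fun j : ℕ => ((j:ℝ) + u) / q) inj
    rw [im] at e4
    rw [e4]
    exact Finset.sum_congr rfl fun h _ => e1 h
  have e3 : ∑ j ∈ Finset.range q, ((j:ℝ) + u) / q = ((q:ℝ) - 1) / 2 + u := by
    rw [← Finset.sum_div, Finset.sum_add_distrib]
    have : ∑ j ∈ Finset.range q, (j:ℝ) = q * (q - 1) / 2 := by
      clear * -
      induction q with
      | zero => simp
      | succ k ih => rw [Finset.sum_range_succ, ih]; push_cast; ring
    rw [this]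
    simp
    field_simp
  unfold psi
  rw [Finset.sum_sub_distrib, e2, e3]
  simp
  rw [abs_le]
  constructor <;> linarith

lemma block_sum (q : ℕ) (hq : 0 < q) (a : ℤ) (hc : IsCoprime a (q:ℤ)) (β δ : ℝ) (t : ℕ → ℝ)
    (ht : ∀ h < q, |t h - (β + a * h / q)| ≤ δ) :
    |∑ h ∈ Finset.range q, psi (t h)| ≤ 2 * δ * q + 1/2 := by
  have hps : ∀ y, psi y = y - ⌊y⌋ - 1/2 := fun y => by unfold psi; rw [Int.fract]
  have up : ∑ h ∈ Finset.range q, psi (t h) ≤ ∑ h ∈ Finset.range q, (psi ((β - δ) + a * h / q) + 2 * δ) := by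
    apply Finset.sum_le_sum
    intro h hh
    have := abs_le.mp (ht h (Finset.mem_range.mp hh))
    rw [hps, hps]
    have : ⌊(β - δ) + a * h / q⌋ ≤ ⌊t h⌋ := Int.floor_le_floor (by linarith)
    have : (⌊(β - δ) + a * h / q⌋ : ℝ) ≤ ⌊t h⌋ := by exact_mod_cast this
    linarith
  have lo : ∑ h ∈ Finset.range q, (psi ((β + δ) + a * h / q) - 2 * δ) ≤ ∑ h ∈ Finset.range q, psi (t h) := by
    apply Finset.sum_le_sum
    intro h hh
    have := abs_le.mp (ht h (Finset.mem_range.mp hh))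
    rw [hps, hps]
    have : ⌊t h⌋ ≤ ⌊(β + δ) + a * h / q⌋ := Int.floor_le_floor (by linarith)
    have : (⌊t h⌋ : ℝ) ≤ ⌊(β + δ) + a * h / q⌋ := by exact_mod_cast this
    linarith
  have r1 := abs_le.mp (res_sum q hq a hc (β - δ))
  have r2 := abs_le.mp (res_sum q hq a hc (β + δ))
  rw [Finset.sum_add_distrib] at up
  rw [Finset.sum_sub_distrib] at lo
  simp only [Finset.sum_const, Finset.card_range, nsmul_eq_mul] at up lo
  rw [abs_le]
  constructor <;> linarith [r1.1, r1.2, r2.1, r2.2]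

/-- the weight -/
noncomputable def wt (f : ℕ → ℝ) (Q : ℕ) (n : ℕ) : ℝ :=
  ∑ q ∈ Finset.Icc 1 Q, if |q * (f (n+1) - f n) - round (q * (f (n+1) - f n))| ≤ 2 / Q then (1:ℝ)/q else 0

lemma wt_nonneg (f : ℕ → ℝ) (Q : ℕ) (n : ℕ) : 0 ≤ wt f Q n := by
  unfold wt
  apply Finset.sum_nonneg
  intro i _
  split_ifs <;> positivity

lemma disc_taylor1 (f : ℕ → ℝ) (Λ : ℝ) (m : ℕ)
    (h0 : ∀ n, m ≤ n → 0 ≤ f (n+2) - 2 * f (n+1) + f n) (h1 : ∀ n, m ≤ n → f (n+2) - 2 * f (n+1) + f n ≤ Λ)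
    (h : ℕ) : 0 ≤ (f (m + h + 1) - f (m + h)) - (f (m+1) - f m) ∧
      (f (m + h + 1) - f (m + h)) - (f (m+1) - f m) ≤ Λ * h := by
  induction h with
  | zero => simp
  | succ k ih =>
    have a := h0 (m+k) (by omega)
    have b := h1 (m+k) (by omega)
    have e : m + (k+1) + 1 = m + k + 2 := by ring
    have e' : m + (k+1) = m + k + 1 := by ring
    rw [e, e']
    push_cast
    constructor <;> linarith [ih.1, ih.2]

lemma disc_taylor2 (f : ℕ → ℝ) (Λ : ℝ) (m : ℕ)
    (h0 : ∀ n, m ≤ n → 0 ≤ f (n+2) - 2 * f (n+1) + f n) (h1 : ∀ n, m ≤ n → f (n+2) - 2 * f (n+1) + f n ≤ Λ)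
    (h : ℕ) : |f (m + h) - (f m + h * (f (m+1) - f m))| ≤ Λ * h ^ 2 := by
  have hΛ : 0 ≤ Λ := (h0 m le_rfl).trans (h1 m le_rfl)
  have key : 0 ≤ f (m + h) - (f m + h * (f (m+1) - f m)) ∧ f (m + h) - (f m + h * (f (m+1) - f m)) ≤ Λ * h ^ 2 := by
    induction h with
    | zero => simp
    | succ k ih =>
      have a := disc_taylor1 f Λ m h0 h1 k
      have e' : m + (k+1) = m + k + 1 := by ring
      rw [e']
      push_cast
      have : 0 ≤ Λ * (k + 1) := by positivity
      constructor
      · linarith [ih.1, a.1]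
      · nlinarith [ih.2, a.2]
  rw [abs_of_nonneg key.1]
  exact key.2

lemma one_block (f : ℕ → ℝ) (Λ : ℝ) (Q : ℕ) (hQ : 1 ≤ Q) (hL : Λ * Q ^ 3 ≤ 1) (m : ℕ)
    (h0 : ∀ n, m ≤ n → 0 ≤ f (n+2) - 2 * f (n+1) + f n) (h1 : ∀ n, m ≤ n → f (n+2) - 2 * f (n+1) + f n ≤ Λ) :
    ∃ q : ℕ, 1 ≤ q ∧ q ≤ Q ∧ |∑ h ∈ Finset.range q, psi (f (m + h))| ≤ 5 ∧
      1 ≤ ∑ h ∈ Finset.range q, wt f Q (m + h) := by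
  have hΛ : 0 ≤ Λ := (h0 m le_rfl).trans (h1 m le_rfl)
  obtain ⟨r, hr1, hr2⟩ := Real.exists_rat_abs_sub_le_and_den_le (f (m+1) - f m) (by omega : 0 < Q)
  set q := r.den with hq
  set a := r.num with ha
  have hq0 : 0 < q := r.den_pos
  have hq' : (0:ℝ) < q := by exact_mod_cast hq0
  have hQ' : (0:ℝ) < Q := by exact_mod_cast (by omega : 0 < Q)
  have hqQ : (q:ℝ) ≤ Q := by exact_mod_cast hr2
  have hr : (r:ℝ) = a / q := by rw [Rat.cast_def]
  rw [hr] at hr1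
  have hr3 : |(f (m+1) - f m) - a / q| ≤ 1 / (Q * q) := by
    refine hr1.trans ?_
    gcongr
    linarith
  have hL2 : Λ * q ^ 2 ≤ 1 / Q := by
    rw [le_div_iff₀ hQ']
    calc Λ * q ^ 2 * Q ≤ Λ * Q ^ 2 * Q := by gcongr
      _ ≤ 1 := by linarith
  refine ⟨q, hq0, hr2, ?_, ?_⟩
  · have hc : IsCoprime a (q:ℤ) := by
      rw [Int.isCoprime_iff_nat_coprime]
      simpa using r.reduced
    have := block_sum q hq0 a hc (f m) (2 / Q) (fun h => f (m + h)) ?_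
    · refine this.trans ?_
      have : 2 * (2 / (Q:ℝ)) * q ≤ 4 := by
        rw [show 2 * (2 / (Q:ℝ)) * q = 4 * (q / Q) by ring]
        have : (q:ℝ) / Q ≤ 1 := (div_le_one hQ').2 hqQ
        linarith
      linarith
    · intro h hh
      have hh' : (h:ℝ) ≤ q := by exact_mod_cast hh.le
      have t := disc_taylor2 f Λ m h0 h1 h
      have e : f (m + h) - (f m + a * h / q) = (f (m + h) - (f m + h * (f (m+1) - f m))) + h * ((f (m+1) - f m) - a / q) := by
        ring
      rw [e]
      refine (abs_add_le _ _).trans ?_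
      rw [abs_mul, abs_of_nonneg (by positivity : (0:ℝ) ≤ h)]
      calc _ ≤ Λ * h ^ 2 + h * (1 / (Q * q)) := by gcongr
        _ ≤ Λ * q ^ 2 + q * (1 / (Q * q)) := by gcongr
        _ ≤ 1 / Q + 1 / Q := by
          have : (q:ℝ) * (1 / (Q * q)) = 1 / Q := by field_simp
          rw [this]; gcongr
        _ = 2 / Q := by ring
  · have : ∀ h ∈ Finset.range q, (1:ℝ) / q ≤ wt f Q (m + h) := by
      intro h hh
      have hh := Finset.mem_range.mp hh
      have hh' : (h:ℝ) ≤ q := by exact_mod_cast hh.le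
      unfold wt
      have hcond : |q * (f (m + h+1) - f (m + h)) - round (q * (f (m + h+1) - f (m + h)))| ≤ 2 / Q := by
        refine (round_le _ a).trans ?_
        have t := disc_taylor1 f Λ m h0 h1 h
        have e : q * (f (m + h+1) - f (m + h)) - a = q * ((f (m + h + 1) - f (m + h)) - (f (m+1) - f m)) + q * ((f (m+1) - f m) - a / q) := by
          field_simp
          ring
        rw [e]
        refine (abs_add_le _ _).trans ?_
        rw [abs_mul, abs_mul, abs_of_nonneg hq'.le, abs_of_nonneg t.1]
        calc _ ≤ q * (Λ * h) + q * (1 / (Q * q)) := by gcongr; exact t.2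
          _ ≤ q * (Λ * q) + q * (1 / (Q * q)) := by gcongr
          _ = Λ * q ^ 2 + 1 / Q := by field_simp
          _ ≤ 1 / Q + 1 / Q := by gcongr
          _ = 2 / Q := by ring
      have := Finset.single_le_sum (f := fun q : ℕ => if |q * (f (m + h+1) - f (m + h)) - round (q * (f (m + h+1) - f (m + h)))| ≤ 2 / Q then (1:ℝ)/q else 0)
        (s := Finset.Icc 1 Q) (fun i _ => by split_ifs <;> positivity) (Finset.mem_Icc.2 ⟨hq0, hr2⟩)
      simp only [hcond, if_true] at this
      exact this
    have := Finset.sum_le_sum this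
    simp only [Finset.sum_const, Finset.card_range, nsmul_eq_mul] at this
    rwa [mul_one_div_cancel hq'.ne'] at this

lemma greedy (f : ℕ → ℝ) (Λ : ℝ) (Q : ℕ) (hQ : 1 ≤ Q) (hL : Λ * Q ^ 3 ≤ 1) (N : ℕ) : ∀ (m : ℕ)
    (h0 : ∀ n, m ≤ n → 0 ≤ f (n+2) - 2 * f (n+1) + f n) (h1 : ∀ n, m ≤ n → f (n+2) - 2 * f (n+1) + f n ≤ Λ),
    |∑ h ∈ Finset.range N, psi (f (m + h))| ≤ 5 * ∑ h ∈ Finset.range N, wt f Q (m + h) + Q := by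
  induction N using Nat.strong_induction_on with
  | _ N ih =>
    intro m h0 h1
    by_cases hN : N < Q
    · have b : |∑ h ∈ Finset.range N, psi (f (m + h))| ≤ N := by
        refine (Finset.abs_sum_le_sum_abs _ _).trans ?_
        refine (Finset.sum_le_sum (fun i _ => (psi_abs (f (m+i))).trans (by norm_num : (1/2:ℝ) ≤ 1))).trans ?_
        simp
      have : 0 ≤ ∑ h ∈ Finset.range N, wt f Q (m + h) := Finset.sum_nonneg fun i _ => wt_nonneg f Q _
      have : (N:ℝ) ≤ Q := by exact_mod_cast hN.le
      linarith
    · obtain ⟨q, hq1, hq2, hq3, hq4⟩ := one_block f Λ Q hQ hL m h0 h1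
      obtain ⟨k, rfl⟩ : ∃ k, N = q + k := ⟨N - q, by omega⟩
      have := ih k (by omega) (m + q) (fun n hn => h0 n (by omega)) (fun n hn => h1 n (by omega))
      rw [Finset.sum_range_add, Finset.sum_range_add]
      simp_rw [← add_assoc]
      refine (abs_add_le _ _).trans ?_
      linarith

lemma gap_le (G : ℕ → ℝ) (μ : ℝ) (N : ℕ) (hg : ∀ h, h + 1 < N → μ ≤ G (h+1) - G h)
    (i k : ℕ) (hk : i + k < N) : μ * k ≤ G (i + k) - G i := by
  induction k with
  | zero => simp
  | succ k ih =>
    have := hg (i + k) (by omega)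
    have := ih (by omega)
    rw [← add_assoc]
    push_cast
    linarith

lemma count_le (G : ℕ → ℝ) (μ η W : ℝ) (hμ : 0 < μ) (hη : 0 ≤ η) (hW : 0 ≤ W) (N : ℕ)
    (hg : ∀ h, h + 1 < N → μ ≤ G (h+1) - G h) (hr : ∀ h < N, G h - G 0 ≤ W) :
    (((Finset.range N).filter (fun h => |G h - round (G h)| ≤ η)).card : ℝ) ≤ (W + 2) * (2 * η / μ + 1) := by
  set S := (Finset.range N).filter (fun h => |G h - round (G h)| ≤ η) with hS
  have c1 := Finset.card_le_mul_card_image (f := fun h => round (G h)) S (⌊2 * η / μ⌋₊ + 1) ?_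
  · have c2 : (((Finset.image (fun h => round (G h)) S).card : ℕ) : ℝ) ≤ W + 2 := by
      have sub : Finset.image (fun h => round (G h)) S ⊆ Finset.Icc (round (G 0)) (round (G 0 + W)) := by
        intro b hb
        simp only [Finset.mem_image, hS, Finset.mem_filter, Finset.mem_range] at hb
        obtain ⟨h, ⟨hh, _⟩, rfl⟩ := hb
        have a1 := gap_le G μ N hg 0 h (by omega)
        rw [zero_add] at a1
        have a2 := hr h hh
        have : 0 ≤ μ * h := by positivity
        rw [Finset.mem_Icc]
        simp only [round_eq]
        constructor <;> apply Int.floor_le_floor <;> linarith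
      have := Finset.card_le_card sub
      rw [Int.card_Icc] at this
      have b1 : (round (G 0 + W) : ℝ) ≤ G 0 + W + 1/2 := by
        rw [round_eq]; exact Int.floor_le _
      have b2 : G 0 - 1/2 ≤ (round (G 0) : ℝ) := by
        rw [round_eq]; linarith [Int.lt_floor_add_one (G 0 + 1/2)]
      have b3 : (((round (G 0 + W) + 1 - round (G 0)).toNat : ℕ) : ℝ) ≤ W + 2 := by
        have : (((round (G 0 + W) + 1 - round (G 0)).toNat : ℤ) : ℝ) = ((max (round (G 0 + W) + 1 - round (G 0)) 0 : ℤ) : ℝ) := by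
          rw [Int.toNat_eq_max]
        rw [Int.cast_natCast] at this
        rw [this]
        push_cast
        apply max_le <;> linarith
      exact le_trans (by exact_mod_cast this) b3
    have c3 : ((⌊2 * η / μ⌋₊ + 1 : ℕ) : ℝ) ≤ 2 * η / μ + 1 := by
      push_cast
      gcongr
      exact Nat.floor_le (by positivity)
    calc (S.card : ℝ) ≤ (((⌊2 * η / μ⌋₊ + 1) * (Finset.image (fun h => round (G h)) S).card : ℕ) : ℝ) := by exact_mod_cast c1
      _ = ((⌊2 * η / μ⌋₊ + 1 : ℕ) : ℝ) * ((Finset.image (fun h => round (G h)) S).card : ℝ) := by push_cast; ring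
      _ ≤ (2 * η / μ + 1) * (W + 2) := by gcongr
      _ = _ := by ring
  · intro b hb
    have hne : ({a ∈ S | round (G a) = b} : Finset ℕ).Nonempty := by
      obtain ⟨x, hx, rfl⟩ := Finset.mem_image.mp hb
      exact ⟨x, Finset.mem_filter.2 ⟨hx, rfl⟩⟩
    set F := ({a ∈ S | round (G a) = b} : Finset ℕ) with hF
    have hmem : ∀ x ∈ F, x < N ∧ |G x - b| ≤ η := by
      intro x hx
      simp only [hF, hS, Finset.mem_filter, Finset.mem_range] at hx
      exact ⟨hx.1.1, by rw [← hx.2]; exact hx.1.2⟩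
    have sub : F ⊆ Finset.Icc (F.min' hne) (F.max' hne) := fun x hx =>
      Finset.mem_Icc.2 ⟨F.min'_le x hx, F.le_max' x hx⟩
    have := Finset.card_le_card sub
    rw [Nat.card_Icc] at this
    have h1 := hmem _ (F.min'_mem hne)
    have h2 := hmem _ (F.max'_mem hne)
    have h3 : F.min' hne ≤ F.max' hne := F.min'_le _ (F.max'_mem hne)
    obtain ⟨k, hk⟩ := Nat.exists_eq_add_of_le h3
    rw [hk] at this h2
    have h4 := gap_le G μ N hg _ k h2.1
    have h5 : (k:ℝ) ≤ 2 * η / μ := by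
      rw [le_div_iff₀ hμ]
      linarith [(abs_le.mp h1.2).1, (abs_le.mp h2.2).2]
    have := Nat.le_floor h5
    omega

lemma wt_sum (f : ℕ → ℝ) (lam Λ : ℝ) (hlam : 0 < lam) (Q : ℕ) (hQ : 1 ≤ Q) (N m : ℕ)
    (h0 : ∀ n, m ≤ n → 0 ≤ f (n+2) - 2 * f (n+1) + f n) (h1 : ∀ n, m ≤ n → f (n+2) - 2 * f (n+1) + f n ≤ Λ)
    (h2 : ∀ n, m ≤ n → n < m + N → lam ≤ f (n+2) - 2 * f (n+1) + f n) :
    ∑ h ∈ Finset.range N, wt f Q (m + h) ≤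
      (1 + Real.log Q) * (4 * Λ / lam * (N / Q) + 2 + 8 / (Q * lam)) + N * Q * Λ := by
  have hΛ : 0 ≤ Λ := (h0 m le_rfl).trans (h1 m le_rfl)
  have hQ' : (0:ℝ) < Q := by exact_mod_cast (by omega : 0 < Q)
  unfold wt
  rw [Finset.sum_comm]
  have step : ∀ q ∈ Finset.Icc 1 Q, ∑ h ∈ Finset.range N,
      (if |(q:ℝ) * (f (m + h+1) - f (m + h)) - round ((q:ℝ) * (f (m + h+1) - f (m + h)))| ≤ 2 / Q then (1:ℝ)/q else 0) ≤
      (4 * Λ / lam * (N / Q) + 2 + 8 / (Q * lam)) * ((q:ℝ)⁻¹) + Λ * N := by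
    intro q hq
    rw [Finset.mem_Icc] at hq
    have hq' : (1:ℝ) ≤ q := by exact_mod_cast hq.1
    have hq0 : (0:ℝ) < q := by linarith
    rw [← Finset.sum_filter, Finset.sum_const, nsmul_eq_mul]
    have c := count_le (fun h => (q:ℝ) * (f (m + h+1) - f (m + h))) (q * lam) (2 / Q) (q * (Λ * N))
      (by positivity) (by positivity) (by positivity) N ?_ ?_
    · calc _ ≤ ((q * (Λ * N) + 2) * (2 * (2 / Q) / (q * lam) + 1)) * (1 / (q:ℝ)) := by gcongr
        _ = (4 * Λ / lam * (N / Q) + 2 + 8 / (Q * lam) * (q:ℝ)⁻¹) * ((q:ℝ)⁻¹) + Λ * N := by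
          field_simp
          ring
        _ ≤ _ := by
          gcongr
          have : (q:ℝ)⁻¹ ≤ 1 := inv_le_one_of_one_le₀ hq'
          have h8 : 0 ≤ 8 / (Q * lam) := by positivity
          nlinarith
    · intro h hh
      have := h2 (m + h) (by omega) (by omega)
      have e : m + (h + 1) + 1 = m + h + 2 := by ring
      have e' : m + (h + 1) = m + h + 1 := by ring
      simp only [e, e']
      nlinarith
    · intro h hh
      have t := (disc_taylor1 f Λ m h0 h1 h).2
      have hh' : (h:ℝ) ≤ N := by exact_mod_cast hh.le
      simp only [add_zero]
      rw [← mul_sub]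
      gcongr
      exact t.trans (by gcongr)
  refine (Finset.sum_le_sum step).trans ?_
  rw [Finset.sum_add_distrib, ← Finset.mul_sum]
  simp only [Finset.sum_const, Nat.card_Icc, nsmul_eq_mul]
  have hh : ∑ q ∈ Finset.Icc 1 Q, ((q:ℝ)⁻¹) ≤ 1 + Real.log Q := by
    have := harmonic_le_one_add_log Q
    rw [harmonic_eq_sum_Icc] at this
    push_cast at this
    exact this
  have : 0 ≤ 4 * Λ / lam * (N / Q) + 2 + 8 / (Q * lam) := by positivity
  have e : ((Q + 1 - 1 : ℕ) : ℝ) = Q := by simp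
  rw [e]
  nlinarith [mul_le_mul_of_nonneg_left hh this]

lemma vdc (f : ℕ → ℝ) (lam Λ : ℝ) (hlam : 0 < lam) (Q : ℕ) (hQ : 1 ≤ Q) (hL : Λ * Q ^ 3 ≤ 1) (N m : ℕ)
    (h1 : ∀ n, m ≤ n → f (n+2) - 2 * f (n+1) + f n ≤ Λ)
    (h0 : ∀ n, m ≤ n → 0 ≤ f (n+2) - 2 * f (n+1) + f n)
    (h2 : ∀ n, m ≤ n → n < m + N → lam ≤ f (n+2) - 2 * f (n+1) + f n) :
    |∑ h ∈ Finset.range N, psi (f (m + h))| ≤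
      5 * ((1 + Real.log Q) * (4 * Λ / lam * (N / Q) + 2 + 8 / (Q * lam)) + N * Q * Λ) + Q := by
  have a := greedy f Λ Q hQ hL N m h0 h1
  have b := wt_sum f lam Λ hlam Q hQ N m h0 h1 h2
  linarith

lemma sd_exists (s a : ℝ) (ha : 0 < a) :
    ∃ ξ, a < ξ ∧ ξ < a + 2 ∧ (a+2) ^ (-s) - 2 * (a+1) ^ (-s) + a ^ (-s) = s * (s+1) * ξ ^ (-s-2) := by
  have hd : ∀ t : ℝ, 0 < t → HasDerivAt (fun t : ℝ => (t+1) ^ (-s) - t ^ (-s)) ((-s) * (t+1) ^ (-s-1) - (-s) * t ^ (-s-1)) t := by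
    intro t ht
    have e1 : HasDerivAt (fun t : ℝ => (t+1) ^ (-s)) ((-s) * (t+1) ^ (-s-1)) t := by
      have := (Real.hasDerivAt_rpow_const (x := t+1) (p := -s) (Or.inl (by positivity))).comp_add_const t 1
      exact this
    exact e1.sub (Real.hasDerivAt_rpow_const (x := t) (p := -s) (Or.inl ht.ne'))
  obtain ⟨c, hc, hc2⟩ := exists_hasDerivAt_eq_slope (fun t : ℝ => (t+1) ^ (-s) - t ^ (-s))
    (fun t => (-s) * (t+1) ^ (-s-1) - (-s) * t ^ (-s-1)) (a := a) (b := a+1) (by linarith)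
    (fun t ht => (hd t (lt_of_lt_of_le ha ht.1)).continuousAt.continuousWithinAt)
    (fun t ht => hd t (ha.trans ht.1))
  have hc0 : 0 < c := ha.trans hc.1
  have hd2 : ∀ t : ℝ, 0 < t → HasDerivAt (fun t : ℝ => (-s) * t ^ (-s-1)) ((-s) * ((-s-1) * t ^ (-s-1-1))) t := by
    intro t ht
    exact (Real.hasDerivAt_rpow_const (x := t) (p := -s-1) (Or.inl ht.ne')).const_mul _
  obtain ⟨ξ, hξ, hξ2⟩ := exists_hasDerivAt_eq_slope (fun t : ℝ => (-s) * t ^ (-s-1))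
    (fun t => (-s) * ((-s-1) * t ^ (-s-1-1))) (a := c) (b := c+1) (by linarith)
    (fun t ht => (hd2 t (lt_of_lt_of_le hc0 ht.1)).continuousAt.continuousWithinAt)
    (fun t ht => hd2 t (hc0.trans ht.1))
  refine ⟨ξ, hc.1.trans hξ.1, by linarith [hc.2, hξ.2], ?_⟩
  have e1 : a + 1 - a = 1 := by ring
  have e2 : c + 1 - c = 1 := by ring
  rw [e1, div_one] at hc2
  rw [e2, div_one] at hξ2
  have e3 : a + 1 + 1 = a + 2 := by ring
  have e4 : -s - 1 - 1 = -s - 2 := by ring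
  rw [e3] at hc2
  rw [e4] at hξ2
  linarith

lemma psi_triv (g : ℕ → ℝ) (N : ℕ) : |∑ h ∈ Finset.range N, psi (g h)| ≤ N := by
  refine (Finset.abs_sum_le_sum_abs _ _).trans ?_
  refine (Finset.sum_le_sum (fun i _ => (psi_abs (g i)).trans (by norm_num : (1/2:ℝ) ≤ 1))).trans ?_
  simp

lemma dyadic_block (s : ℝ) (hs : 0 < s) (hs2 : s ≤ 3/2) : ∃ K : ℝ, 0 < K ∧ ∀ X : ℝ, 1 ≤ X → ∀ M N : ℕ, 1 ≤ M →
    (M:ℝ) ≤ X → N ≤ M →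
    |∑ h ∈ Finset.range N, psi (X ^ (1+s) * ((M + h : ℕ) : ℝ) ^ (-s))| ≤ K * (X ^ (3/4 : ℝ) * (1 + Real.log X)) := by
  set c := s * (s+1) with hc
  have hc0 : 0 < c := by positivity
  have hc1 : c ≤ 8 := by nlinarith
  refine ⟨5 * (16 * 4 ^ (s+2) + 2 + 8 * (4 * 4 ^ (s+2) / c) + 4) + 2, by positivity, ?_⟩
  intro X hX M N hM hMX hNM
  have hX0 : 0 < X := by linarith
  have hM0 : (0:ℝ) < M := by exact_mod_cast hM
  have hN : (N:ℝ) ≤ M := by exact_mod_cast hNM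
  have hlX : 0 ≤ Real.log X := Real.log_nonneg hX
  set Y := X ^ (3/4 : ℝ) with hY
  have hY1 : 1 ≤ Y := Real.one_le_rpow hX (by norm_num)
  have hY0 : 0 < Y := by linarith
  set L := 1 + Real.log X with hL
  have hL1 : 1 ≤ L := by linarith
  have hYL : Y ≤ Y * L := by nlinarith
  by_cases hcase : (M:ℝ) < 2 * Y
  · refine (psi_triv _ N).trans ?_
    have : 0 ≤ 5 * (16 * (4:ℝ) ^ (s+2) + 2 + 8 * (4 * 4 ^ (s+2) / c) + 4) := by positivity
    have : 0 ≤ Y * L := by positivity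
    nlinarith
  push Not at hcase
  set A := X ^ (1+s) with hA
  have hA0 : 0 < A := by positivity
  set Q := ⌊(M:ℝ) / (2 * Y)⌋₊ with hQ
  have hr1 : 1 ≤ (M:ℝ) / (2 * Y) := by rw [le_div_iff₀ (by positivity)]; linarith
  have hQ1 : 1 ≤ Q := Nat.le_floor (by simpa using hr1)
  have hQ1' : (1:ℝ) ≤ Q := by exact_mod_cast hQ1
  have hQ0 : (0:ℝ) < Q := by linarith
  have hQu : (Q:ℝ) ≤ M / (2 * Y) := Nat.floor_le (by positivity)
  have hQl : (M:ℝ) / (4 * Y) ≤ Q := by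
    have := Nat.lt_floor_add_one ((M:ℝ) / (2 * Y))
    have e : (M:ℝ) / (4 * Y) = (M / (2 * Y)) / 2 := by field_simp; norm_num
    rw [e]
    linarith
  have hMQ : (M:ℝ) ≤ 4 * Y * Q := by
    rw [div_le_iff₀ (by positivity)] at hQl; linarith
  set Λ := A * (c * (M:ℝ) ^ (-s-2)) with hΛ
  set lam := A * (c * (4 * (M:ℝ)) ^ (-s-2)) with hlam
  have hlam0 : 0 < lam := by positivity
  have hΛ0 : 0 < Λ := by positivity
  have hrat : Λ / lam = 4 ^ (s+2) := by
    rw [hΛ, hlam, Real.mul_rpow (by norm_num) hM0.le, show s + 2 = -(-s-2) by ring, Real.rpow_neg (by norm_num : (0:ℝ) ≤ 4)]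
    field_simp
  -- key smallness
  have hpow : A * (M:ℝ) ^ (-s-2) * M ^ 3 ≤ Y ^ 3 := by
    have e1 : (M:ℝ) ^ (-s-2) * M ^ 3 = (M:ℝ) ^ (1 - s) := by
      rw [← Real.rpow_natCast, ← Real.rpow_add hM0]; congr 1; push_cast; ring
    have e2 : Y ^ 3 = X ^ (9/4 : ℝ) := by
      rw [hY, ← Real.rpow_natCast, ← Real.rpow_mul hX0.le]; norm_num
    rw [mul_assoc, e1, e2, hA]
    rcases le_total s 1 with h | h
    · calc X ^ (1+s) * (M:ℝ) ^ (1-s) ≤ X ^ (1+s) * X ^ (1-s) := by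
            gcongr
        _ = X ^ (2:ℝ) := by rw [← Real.rpow_add hX0]; congr 1; ring
        _ ≤ _ := Real.rpow_le_rpow_of_exponent_le hX (by norm_num)
    · calc X ^ (1+s) * (M:ℝ) ^ (1-s) ≤ X ^ (1+s) * Y ^ (1-s) := by
            gcongr ?_ * ?_
            exact Real.rpow_le_rpow_of_nonpos hY0 (by linarith) (by linarith)
        _ = X ^ ((1+s) + 3/4 * (1-s)) := by rw [hY, ← Real.rpow_mul hX0.le, ← Real.rpow_add hX0]
        _ ≤ _ := Real.rpow_le_rpow_of_exponent_le hX (by linarith)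
  have hsm : Λ * Q ^ 3 ≤ 1 := by
    calc Λ * Q ^ 3 ≤ Λ * (M / (2 * Y)) ^ 3 := by gcongr
      _ = (c / 8) * (A * (M:ℝ) ^ (-s-2) * M ^ 3) / Y ^ 3 := by rw [hΛ]; field_simp; norm_num
      _ ≤ 1 * (Y ^ 3) / Y ^ 3 := by gcongr; linarith
      _ = 1 := by field_simp
  have hsd : ∀ n : ℕ, M ≤ n → ∃ ξ : ℝ, (n:ℝ) < ξ ∧ ξ < n + 2 ∧
      (A * ((n+2 : ℕ) : ℝ) ^ (-s)) - 2 * (A * ((n+1 : ℕ) : ℝ) ^ (-s)) + (A * (n : ℝ) ^ (-s)) = A * (c * ξ ^ (-s-2)) := by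
    intro n hn
    have hn0 : (0:ℝ) < n := by exact_mod_cast (by omega : 0 < n)
    obtain ⟨ξ, h1, h2, h3⟩ := sd_exists s n hn0
    refine ⟨ξ, h1, h2, ?_⟩
    rw [hc, ← h3]
    push_cast
    ring
  have main := vdc (fun n => A * (n:ℝ) ^ (-s)) lam Λ hlam0 Q hQ1 hsm N M ?_ ?_ ?_
  · refine main.trans ?_
    have hlogQ : Real.log Q ≤ Real.log X := by
      apply Real.log_le_log hQ0
      have : (M:ℝ) / (2 * Y) ≤ M := div_le_self hM0.le (by linarith)
      linarith
    have hlogQ0 : 0 ≤ Real.log Q := Real.log_nonneg hQ1'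
    have hNQ : (N:ℝ) / Q ≤ 4 * Y := by rw [div_le_iff₀ hQ0]; linarith
    have h3 : (N:ℝ) * Q * Λ ≤ 4 * Y := by
      have : (N:ℝ) * Q * Λ = (N:ℝ) / Q * (1 / Q) * (Λ * Q ^ 3) := by field_simp
      rw [this]
      have i1 : 1 / (Q:ℝ) ≤ 1 := by rw [div_le_one hQ0]; exact hQ1'
      calc _ ≤ 4 * Y * 1 * 1 := by gcongr
        _ = 4 * Y := by ring
    have hQY : (Q:ℝ) ≤ Y := by
      refine hQu.trans ?_
      rw [div_le_iff₀ (by positivity)]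
      have : X ≤ Y * Y := by
        rw [hY, ← Real.rpow_add hX0]
        calc X = X ^ (1:ℝ) := by simp
          _ ≤ _ := Real.rpow_le_rpow_of_exponent_le hX (by norm_num)
      nlinarith
    have h8 : 1 / (Q * lam) ≤ 4 * 4 ^ (s+2) / c * Y := by
      have hll : lam = Λ / 4 ^ (s+2) := by rw [← hrat]; field_simp
      have hcY : c ≤ Λ * M := by
        have e1 : (M:ℝ) ^ (-s-2) * M = (M:ℝ) ^ (-(1 + s)) := by
          rw [← Real.rpow_add_one hM0.ne']; congr 1; ring
        have : 1 ≤ A * (M:ℝ) ^ (-(1+s)) := by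
          rw [Real.rpow_neg hM0.le, hA]
          rw [← div_eq_mul_inv, one_le_div (by positivity)]
          gcongr
        calc c = c * 1 := by ring
          _ ≤ c * (A * (M:ℝ) ^ (-(1+s))) := by gcongr
          _ = Λ * M := by rw [hΛ, ← e1]; ring
      have h4 : (0:ℝ) < 4 ^ (s+2) := by positivity
      rw [hll, div_le_iff₀ (by positivity)]
      calc (1:ℝ) = (1 / c) * c := by field_simp
        _ ≤ (1 / c) * (Λ * (4 * Y * Q)) := by
          gcongr
          exact hcY.trans (by gcongr)
        _ = _ := by field_simp
    have e8 : 8 / (Q * lam) = 8 * (1 / (Q * lam)) := by ring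
    have e4 : 4 * Λ / lam = 4 * 4 ^ (s+2) := by rw [mul_div_assoc, hrat]
    rw [e8, e4]
    calc _ ≤ 5 * (L * (4 * 4 ^ (s+2) * (4 * Y) + 2 * Y + 8 * (4 * 4 ^ (s+2) / c * Y)) + 4 * Y) + Y := by
          gcongr
          linarith
          linarith
      _ ≤ 5 * (L * (4 * 4 ^ (s+2) * (4 * Y) + 2 * Y + 8 * (4 * 4 ^ (s+2) / c * Y)) + 4 * (Y * L)) + 2 * (Y * L) := by
          have : 0 ≤ Y * L := by positivity
          gcongr
          linarith
      _ = _ := by ring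
  · intro n hn
    obtain ⟨ξ, h1, h2, h3⟩ := hsd n hn
    have hn' : (M:ℝ) ≤ n := by exact_mod_cast hn
    rw [h3, hΛ]
    gcongr A * (c * ?_)
    exact Real.rpow_le_rpow_of_nonpos hM0 (by linarith) (by linarith)
  · intro n hn
    obtain ⟨ξ, h1, h2, h3⟩ := hsd n hn
    have hn' : (M:ℝ) ≤ n := by exact_mod_cast hn
    have : 0 < ξ := by linarith
    rw [h3]
    positivity
  · intro n hn hnN
    obtain ⟨ξ, h1, h2, h3⟩ := hsd n hn
    have hn' : (M:ℝ) ≤ n := by exact_mod_cast hn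
    have hn2 : (n:ℝ) + 2 ≤ 4 * M := by exact_mod_cast (by omega : n + 2 ≤ 4 * M)
    have : 0 < ξ := by linarith
    rw [h3, hlam]
    gcongr A * (c * ?_)
    exact Real.rpow_le_rpow_of_nonpos this (by linarith) (by linarith)

lemma psi_final (s : ℝ) (hs : 0 < s) (hs2 : s ≤ 3/2) : ∃ K : ℝ, 0 < K ∧ ∀ X : ℝ, 1 ≤ X → ∀ y : ℕ, (y:ℝ) ≤ X →
    |∑ n ∈ Finset.range y, psi (X ^ (1+s) * ((n:ℝ) + 1) ^ (-s))| ≤ K * X ^ (4/5 : ℝ) := by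
  obtain ⟨K, hK, hb⟩ := dyadic_block s hs hs2
  refine ⟨K * (2 * 41 ^ 2), by positivity, ?_⟩
  intro X hX y hy
  have hX0 : 0 < X := by linarith
  have hlX : 0 ≤ Real.log X := Real.log_nonneg hX
  set B := K * (X ^ (3/4 : ℝ) * (1 + Real.log X)) with hB
  have hB0 : 0 ≤ B := by positivity
  have key : ∀ k y : ℕ, y < 2 ^ k → (y:ℝ) ≤ X →
      |∑ n ∈ Finset.range y, psi (X ^ (1+s) * ((n:ℝ) + 1) ^ (-s))| ≤ k * B := by
    intro k
    induction k with
    | zero =>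
      intro y h _
      have : y = 0 := by simpa using h
      simp [this]
    | succ k ih =>
      intro y h hy
      rcases Nat.eq_zero_or_pos y with rfl | hpos
      · simp; positivity
      obtain ⟨N, hN⟩ : ∃ N, y = y / 2 + N := ⟨y - y / 2, by omega⟩
      have h1 := ih (y/2) (by rw [pow_succ] at h; omega) (le_trans (by exact_mod_cast (by omega : y/2 ≤ y)) hy)
      have h2 := hb X hX (y/2 + 1) N (by omega) (le_trans (by exact_mod_cast (by omega : y/2 + 1 ≤ y)) hy) (by omega)
      rw [hN, Finset.sum_range_add]
      refine (abs_add_le _ _).trans ?_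
      have e : ∑ x ∈ Finset.range N, psi (X ^ (1+s) * (((y/2 + x : ℕ):ℝ) + 1) ^ (-s)) =
        ∑ h ∈ Finset.range N, psi (X ^ (1+s) * ((y/2 + 1 + h : ℕ) : ℝ) ^ (-s)) := by
        apply Finset.sum_congr rfl
        intro x _
        congr 3
        push_cast
        ring
      have e0 : y / 2 + N - N = y / 2 := by omega
      rw [e]
      push_cast at h1 h2 ⊢
      linarith
  have h1 := key (Nat.log 2 y + 1) y (Nat.lt_pow_succ_log_self (by norm_num) y) hy
  have h2 : ((Nat.log 2 y + 1 : ℕ) : ℝ) ≤ 2 * (1 + Real.log X) := by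
    push_cast
    rcases Nat.eq_zero_or_pos y with rfl | hpos
    · simp; linarith
    have hy0 : (0:ℝ) < y := by exact_mod_cast hpos
    have a := Real.natLog_le_logb y 2
    rw [Real.logb, Nat.cast_ofNat] at a
    have b : Real.log y / Real.log 2 ≤ 2 * Real.log X := by
      have l2 : 1/2 < Real.log 2 := by linarith [Real.log_two_gt_d9]
      rw [div_le_iff₀ (by linarith)]
      have : Real.log y ≤ Real.log X := Real.log_le_log hy0 hy
      nlinarith
    linarith
  have h3 : 1 + Real.log X ≤ 41 * X ^ (1/40 : ℝ) := by
    have a := Real.log_le_rpow_div hX0.le (by norm_num : (0:ℝ) < 1/40)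
    have b : 1 ≤ X ^ (1/40 : ℝ) := Real.one_le_rpow hX (by norm_num)
    have e : X ^ (1/40 : ℝ) / (1/40) = 40 * X ^ (1/40 : ℝ) := by ring
    linarith
  refine h1.trans ?_
  calc _ ≤ (2 * (1 + Real.log X)) * B := by gcongr
    _ = K * (2 * (1 + Real.log X)^2) * X ^ (3/4:ℝ) := by rw [hB]; ring
    _ ≤ K * (2 * (41 * X ^ (1/40 : ℝ))^2) * X ^ (3/4:ℝ) := by gcongr
    _ = K * (2 * 41^2) * (X ^ (1/40:ℝ) * X ^ (1/40:ℝ) * X ^ (3/4:ℝ)) := by ring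
    _ = _ := by rw [← Real.rpow_add hX0, ← Real.rpow_add hX0]; norm_num

lemma rho52 (ρ t : ℝ) (h : ρ = 1 + t) (h0 : 0 ≤ t) (h1 : t ≤ 1) :
    0 ≤ ρ ^ (5/2 : ℝ) - 1 - 5/2 * t ∧ ρ ^ (5/2 : ℝ) - 1 - 5/2 * t ≤ 8 * t ^ 2 := by
  have hρ : 0 ≤ ρ := by linarith
  set v := ρ ^ (1/2 : ℝ) with hv
  have hv1 : 1 ≤ v := Real.one_le_rpow (by linarith) (by norm_num)
  have hv2 : v ^ 2 = ρ := by rw [hv, ← Real.rpow_natCast, ← Real.rpow_mul hρ]; norm_num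
  have hv5 : ρ ^ (5/2 : ℝ) = v ^ 5 := by rw [hv, ← Real.rpow_natCast, ← Real.rpow_mul hρ]; norm_num
  have ht : t = (v - 1) * (v + 1) := by nlinarith
  have hvu : v ≤ 3/2 := by nlinarith
  have e : v ^ 5 - 1 - 5/2 * ((v - 1) * (v + 1)) = (v-1)^2 * (v^3 + 2 * v^2 + 3 * v + 3/2) := by ring
  rw [hv5, ht, e]
  constructor
  · positivity
  · have : v^3 + 2 * v^2 + 3 * v + 3/2 ≤ 8 * (v+1)^2 := by nlinarith
    calc _ ≤ (v-1)^2 * (8 * (v+1)^2) := by gcongr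
      _ = _ := by ring

lemma rho53 (ρ t : ℝ) (h : ρ = 1 + t) (h0 : 0 ≤ t) (h1 : t ≤ 1) :
    0 ≤ ρ ^ (5/3 : ℝ) - 1 - 5/3 * t ∧ ρ ^ (5/3 : ℝ) - 1 - 5/3 * t ≤ 8 * t ^ 2 := by
  have hρ : 0 ≤ ρ := by linarith
  set v := ρ ^ (1/3 : ℝ) with hv
  have hv1 : 1 ≤ v := Real.one_le_rpow (by linarith) (by norm_num)
  have hv2 : v ^ 3 = ρ := by rw [hv, ← Real.rpow_natCast, ← Real.rpow_mul hρ]; norm_num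
  have hv5 : ρ ^ (5/3 : ℝ) = v ^ 5 := by rw [hv, ← Real.rpow_natCast, ← Real.rpow_mul hρ]; norm_num
  have ht : t = (v - 1) * (v ^ 2 + v + 1) := by nlinarith
  have hvu : v ≤ 2 := by
    by_contra hh
    push Not at hh
    nlinarith [sq_nonneg v]
  have e : v ^ 5 - 1 - 5/3 * ((v - 1) * (v ^ 2 + v + 1)) = (v-1)^2 * (v^3 + 2 * v^2 + 4/3 * v + 2/3) := by ring
  rw [hv5, ht, e]
  constructor
  · positivity
  · have : v^3 + 2 * v^2 + 4/3 * v + 2/3 ≤ 8 * (v ^ 2 + v+1)^2 := by nlinarith [sq_nonneg v, mul_pos (by linarith : 0 < v) (by linarith : 0 < v), pow_pos (by linarith : 0 < v) 3, pow_pos (by linarith : 0 < v) 4]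
    calc _ ≤ (v-1)^2 * (8 * (v ^ 2 + v+1)^2) := by gcongr
      _ = _ := by ring

noncomputable def TS (x : ℝ) : Finset (ℕ × ℕ) :=
  (Finset.Icc 1 ⌊x⌋₊ ×ˢ Finset.Icc 1 ⌊x⌋₊).filter (fun p => (p.1:ℝ)^2*(p.2:ℝ)^3 ≤ x)

lemma mem_TS (x : ℝ) (p : ℕ × ℕ) : p ∈ TS x ↔ 1 ≤ p.1 ∧ 1 ≤ p.2 ∧ (p.1:ℝ)^2*(p.2:ℝ)^3 ≤ x := by
  unfold TS
  simp only [Finset.mem_filter, Finset.mem_product, Finset.mem_Icc]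
  constructor
  · rintro ⟨⟨⟨h1, _⟩, ⟨h2, _⟩⟩, h3⟩; exact ⟨h1, h2, h3⟩
  · rintro ⟨h1, h2, h3⟩
    have a1 : (1:ℝ) ≤ p.1 := by exact_mod_cast h1
    have a2 : (1:ℝ) ≤ p.2 := by exact_mod_cast h2
    have b1 : (p.1:ℝ) ≤ (p.1:ℝ)^2 := by nlinarith
    have b2 : (1:ℝ) ≤ (p.1:ℝ)^2 := by nlinarith
    have c1 : (1:ℝ) ≤ (p.2:ℝ)^3 := one_le_pow₀ a2
    have c2 : (p.2:ℝ) ≤ (p.2:ℝ)^3 := le_self_pow₀ a2 (by norm_num)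
    refine ⟨⟨⟨h1, Nat.le_floor ?_⟩, ⟨h2, Nat.le_floor ?_⟩⟩, h3⟩ <;> nlinarith

lemma ps_floor (u : ℝ) (hu : 0 ≤ u) : ((⌊u⌋₊ : ℕ) : ℝ) = u - 1/2 - psi u := by
  unfold psi
  rw [Int.fract, ← natCast_floor_eq_intCast_floor hu]
  ring

lemma iff_a (X a b : ℝ) (hX : 0 < X) (ha : 0 < a) (hb : 0 < b) :
    a ^ 2 * b ^ 3 ≤ X ^ 5 ↔ a ≤ X ^ (1 + 3/2 : ℝ) * b ^ (-(3/2) : ℝ) := by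
  have hu : 0 ≤ X ^ (1 + 3/2 : ℝ) * b ^ (-(3/2) : ℝ) := by positivity
  rw [← pow_le_pow_iff_left₀ ha.le hu (two_ne_zero), mul_pow]
  have e1 : (X ^ (1 + 3/2 : ℝ)) ^ 2 = X ^ 5 := by
    rw [← Real.rpow_natCast, ← Real.rpow_natCast, ← Real.rpow_mul hX.le]; norm_num
  have e2 : (b ^ (-(3/2) : ℝ)) ^ 2 = (b ^ 3)⁻¹ := by
    rw [← Real.rpow_natCast, ← Real.rpow_natCast, ← Real.rpow_mul hb.le, ← Real.rpow_neg hb.le]; norm_num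
  rw [e1, e2, ← div_eq_mul_inv, le_div_iff₀ (by positivity)]

lemma iff_b (X a b : ℝ) (hX : 0 < X) (ha : 0 < a) (hb : 0 < b) :
    a ^ 2 * b ^ 3 ≤ X ^ 5 ↔ b ≤ X ^ (1 + 2/3 : ℝ) * a ^ (-(2/3) : ℝ) := by
  have hu : 0 ≤ X ^ (1 + 2/3 : ℝ) * a ^ (-(2/3) : ℝ) := by positivity
  rw [← pow_le_pow_iff_left₀ hb.le hu (three_ne_zero), mul_pow]
  have e1 : (X ^ (1 + 2/3 : ℝ)) ^ 3 = X ^ 5 := by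
    rw [← Real.rpow_natCast, ← Real.rpow_natCast, ← Real.rpow_mul hX.le]; norm_num
  have e2 : (a ^ (-(2/3) : ℝ)) ^ 3 = (a ^ 2)⁻¹ := by
    rw [← Real.rpow_natCast, ← Real.rpow_natCast, ← Real.rpow_mul ha.le, ← Real.rpow_neg ha.le]; norm_num
  rw [e1, e2, ← div_eq_mul_inv, le_div_iff₀ (by positivity), mul_comm]

lemma cardS1 (X : ℝ) (hX : 1 ≤ X) (y : ℕ) :
    (((TS (X^5)).filter (fun p => p.2 ≤ y)).card) = ∑ n ∈ Finset.range y, ⌊X ^ (1 + 3/2 : ℝ) * ((n:ℝ)+1) ^ (-(3/2) : ℝ)⌋₊ := by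
  have hX0 : 0 < X := by linarith
  rw [Finset.card_eq_sum_card_fiberwise (f := fun p => p.2 - 1) (t := Finset.range y)]
  · apply Finset.sum_congr rfl
    intro n hn
    rw [Finset.mem_range] at hn
    rw [← Nat.add_sub_cancel (n := ⌊X ^ (1 + 3/2 : ℝ) * ((n:ℝ)+1) ^ (-(3/2) : ℝ)⌋₊) (m := 1), ← Nat.card_Icc]
    symm
    apply Finset.card_bij (fun a _ => (a, n+1))
    · intro a ha
      rw [Finset.mem_Icc] at ha
      simp only [Finset.mem_filter, mem_TS]
      refine ⟨⟨⟨ha.1, by omega, ?_⟩, by omega⟩, by omega⟩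
      have := (Nat.le_floor_iff (by positivity)).1 ha.2
      have := (iff_a X a ((n:ℝ)+1) hX0 (by exact_mod_cast ha.1) (by positivity)).2 this
      push_cast
      exact this
    · intro a _ b _ h
      simpa using h
    · intro p hp
      simp only [Finset.mem_filter, mem_TS] at hp
      obtain ⟨⟨⟨h1, h2, h3⟩, h4⟩, h5⟩ := hp
      have e : p.2 = n + 1 := by omega
      refine ⟨p.1, ?_, by ext <;> simp [e]⟩
      rw [Finset.mem_Icc]
      refine ⟨h1, Nat.le_floor ?_⟩
      rw [e] at h3
      push_cast at h3
      exact (iff_a X p.1 ((n:ℝ)+1) hX0 (by exact_mod_cast h1) (by positivity)).1 h3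
  · intro p hp
    simp only [Finset.coe_filter, Set.mem_ofPred_eq, mem_TS] at hp
    simp only [Finset.coe_range, Set.mem_Iio]
    omega

lemma cardS2 (X : ℝ) (hX : 1 ≤ X) (y : ℕ) :
    (((TS (X^5)).filter (fun p => p.1 ≤ y)).card) = ∑ n ∈ Finset.range y, ⌊X ^ (1 + 2/3 : ℝ) * ((n:ℝ)+1) ^ (-(2/3) : ℝ)⌋₊ := by
  have hX0 : 0 < X := by linarith
  rw [Finset.card_eq_sum_card_fiberwise (f := fun p => p.1 - 1) (t := Finset.range y)]
  · apply Finset.sum_congr rfl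
    intro n hn
    rw [Finset.mem_range] at hn
    rw [← Nat.add_sub_cancel (n := ⌊X ^ (1 + 2/3 : ℝ) * ((n:ℝ)+1) ^ (-(2/3) : ℝ)⌋₊) (m := 1), ← Nat.card_Icc]
    symm
    apply Finset.card_bij (fun a _ => (n+1, a))
    · intro a ha
      rw [Finset.mem_Icc] at ha
      simp only [Finset.mem_filter, mem_TS]
      refine ⟨⟨⟨by omega, ha.1, ?_⟩, by omega⟩, by omega⟩
      have := (Nat.le_floor_iff (by positivity)).1 ha.2
      have := (iff_b X ((n:ℝ)+1) a hX0 (by positivity) (by exact_mod_cast ha.1)).2 this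
      push_cast
      exact this
    · intro a _ b _ h
      simpa using h
    · intro p hp
      simp only [Finset.mem_filter, mem_TS] at hp
      obtain ⟨⟨⟨h1, h2, h3⟩, h4⟩, h5⟩ := hp
      have e : p.1 = n + 1 := by omega
      refine ⟨p.2, ?_, by ext <;> simp [e]⟩
      rw [Finset.mem_Icc]
      refine ⟨h2, Nat.le_floor ?_⟩
      rw [e] at h3
      push_cast at h3
      exact (iff_b X ((n:ℝ)+1) p.2 hX0 (by positivity) (by exact_mod_cast h2)).1 h3
  · intro p hp
    simp only [Finset.coe_filter, Set.mem_ofPred_eq, mem_TS] at hp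
    simp only [Finset.coe_range, Set.mem_Iio]
    omega

lemma cardT (X : ℝ) (hX : 1 ≤ X) :
    (TS (X^5)).card + ⌊X⌋₊ ^ 2 = ((TS (X^5)).filter (fun p => p.2 ≤ ⌊X⌋₊)).card + ((TS (X^5)).filter (fun p => p.1 ≤ ⌊X⌋₊)).card := by
  have hX0 : 0 < X := by linarith
  set y := ⌊X⌋₊ with hy
  rw [← Finset.card_union_add_card_inter]
  congr 1
  · congr 1
    ext p
    simp only [Finset.mem_union, Finset.mem_filter]
    constructor
    · intro hp
      by_contra hcon
      have h1 : X < p.1 := by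
        rw [← Nat.floor_lt hX0.le]; by_contra h; apply hcon; right; exact ⟨hp, by omega⟩
      have h2 : X < p.2 := by
        rw [← Nat.floor_lt hX0.le]; by_contra h; apply hcon; left; exact ⟨hp, by omega⟩
      have h3 := ((mem_TS _ _).1 hp).2.2
      have : X ^ 2 * X ^ 3 < (p.1:ℝ)^2 * (p.2:ℝ)^3 := by gcongr
      nlinarith
    · rintro (h | h) <;> exact h.1
  · have : (TS (X^5)).filter (fun p => p.2 ≤ y) ∩ (TS (X^5)).filter (fun p => p.1 ≤ y) = Finset.Icc 1 y ×ˢ Finset.Icc 1 y := by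
      ext p
      simp only [Finset.mem_inter, Finset.mem_filter, Finset.mem_product, Finset.mem_Icc, mem_TS]
      constructor
      · rintro ⟨⟨⟨h1, h2, h3⟩, h4⟩, ⟨_, h5⟩⟩; exact ⟨⟨h1, h5⟩, ⟨h2, h4⟩⟩
      · rintro ⟨⟨h1, h5⟩, ⟨h2, h4⟩⟩
        have hyX : (y:ℝ) ≤ X := Nat.floor_le hX0.le
        have a1 : (p.1:ℝ) ≤ X := le_trans (by exact_mod_cast h5) hyX
        have a2 : (p.2:ℝ) ≤ X := le_trans (by exact_mod_cast h4) hyX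
        have : (p.1:ℝ)^2 * (p.2:ℝ)^3 ≤ X ^ 5 := by
          calc _ ≤ X ^ 2 * X ^ 3 := by gcongr
            _ = _ := by ring
        exact ⟨⟨⟨h1, h2, this⟩, h4⟩, ⟨⟨h1, h2, this⟩, h5⟩⟩
    rw [this, Finset.card_product]
    simp
    ring

/-- one-sided sum -/
lemma side (s : ℝ) (h1 : 1/2 < s) (h2 : s ≤ 3/2) (h3 : s ≠ 1) : ∃ K : ℝ, 0 < K ∧ ∀ X : ℝ, 1 ≤ X →
    |((∑ n ∈ Finset.range ⌊X⌋₊, ⌊X ^ (1 + s) * ((n:ℝ)+1) ^ (-s)⌋₊ : ℕ) : ℝ) -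
      ((riemannZeta (s:ℂ)).re * X ^ (1+s) + (⌊X⌋₊:ℝ)^2 * (X / ⌊X⌋₊) ^ (1+s) / (1-s) + (⌊X⌋₊:ℝ) * (X / ⌊X⌋₊) ^ (1+s) / 2 - (⌊X⌋₊:ℝ)/2)|
      ≤ K * X ^ (4/5 : ℝ) := by
  obtain ⟨K, hK, hpsi⟩ := psi_final s (by linarith) h2
  refine ⟨K + s / 2 * 2 ^ (1+s), by positivity, ?_⟩
  intro X hX
  have hX0 : 0 < X := by linarith
  set y := ⌊X⌋₊ with hy
  have hy1 : 1 ≤ y := Nat.le_floor (by simpa using hX)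
  have hy1' : (1:ℝ) ≤ y := by exact_mod_cast hy1
  have hy0 : (0:ℝ) < y := by linarith
  have hyX : (y:ℝ) ≤ X := Nat.floor_le hX0.le
  have hXy : X ≤ 2 * y := by linarith [Nat.lt_floor_add_one X]
  set A := X ^ (1+s) with hA
  have hA0 : 0 < A := by positivity
  have e1 : ((∑ n ∈ Finset.range y, ⌊A * ((n:ℝ)+1) ^ (-s)⌋₊ : ℕ) : ℝ) =
      A * (∑ n ∈ Finset.range y, ((n:ℝ)+1) ^ (-s)) - y / 2 - ∑ n ∈ Finset.range y, psi (A * ((n:ℝ)+1) ^ (-s)) := by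
    push_cast
    rw [Finset.sum_congr rfl (fun (n:ℕ) _ => ps_floor (A * ((n:ℝ)+1) ^ (-s)) (by positivity))]
    rw [Finset.sum_sub_distrib, Finset.sum_sub_distrib, Finset.mul_sum]
    simp
    ring
  have em := em_main s h1 (by linarith) h3 y hy1
  set E := ∑ n ∈ Finset.range y, ((n:ℝ) + 1) ^ (-s) - (y:ℝ) ^ (1 - s) / (1 - s) - (y:ℝ) ^ (-s) / 2
      - (riemannZeta (s:ℂ)).re with hE
  have hps := hpsi X hX y hyX
  set P := ∑ n ∈ Finset.range y, psi (A * ((n:ℝ)+1) ^ (-s)) with hP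
  have hdiv : (X / y) ^ (1+s) = A * (y:ℝ) ^ (-s-1) := by
    rw [Real.div_rpow hX0.le hy0.le, div_eq_mul_inv, ← Real.rpow_neg hy0.le, hA]
    congr 2; ring
  have p1 : (y:ℝ)^2 * (y:ℝ) ^ (-s-1) = (y:ℝ) ^ (1-s) := by
    rw [← Real.rpow_natCast, ← Real.rpow_add hy0]; congr 1; push_cast; ring
  have p2 : (y:ℝ) * (y:ℝ) ^ (-s-1) = (y:ℝ) ^ (-s) := by
    rw [mul_comm, ← Real.rpow_add_one hy0.ne']; congr 1; ring
  have e2 : ((∑ n ∈ Finset.range y, ⌊A * ((n:ℝ)+1) ^ (-s)⌋₊ : ℕ) : ℝ) -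
      ((riemannZeta (s:ℂ)).re * A + (y:ℝ)^2 * (X / y) ^ (1+s) / (1-s) + (y:ℝ) * (X / y) ^ (1+s) / 2 - (y:ℝ)/2)
      = A * E - P := by
    rw [e1, hE, hdiv]
    rw [show (y:ℝ)^2 * (A * (y:ℝ) ^ (-s-1)) = A * ((y:ℝ)^2 * (y:ℝ) ^ (-s-1)) by ring, p1,
      show (y:ℝ) * (A * (y:ℝ) ^ (-s-1)) = A * ((y:ℝ) * (y:ℝ) ^ (-s-1)) by ring, p2]
    ring
  rw [e2]
  have hAE : |A * E| ≤ s / 2 * 2 ^ (1+s) := by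
    rw [abs_mul, abs_of_pos hA0]
    calc A * |E| ≤ A * (s / 2 * (y:ℝ) ^ (-s-1)) := by gcongr
      _ = s / 2 * (X / y) ^ (1+s) := by rw [hdiv]; ring
      _ ≤ _ := by
        gcongr
        rw [div_le_iff₀ hy0]; exact hXy
  have hX45 : 1 ≤ X ^ (4/5 : ℝ) := Real.one_le_rpow hX (by norm_num)
  calc |A * E - P| ≤ |A * E| + |P| := abs_sub _ _
    _ ≤ s / 2 * 2 ^ (1+s) * 1 + K * X ^ (4/5 : ℝ) := by linarith
    _ ≤ s / 2 * 2 ^ (1+s) * X ^ (4/5 : ℝ) + K * X ^ (4/5 : ℝ) := by gcongr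
    _ = _ := by ring

lemma T_asymp_X : ∃ K : ℝ, 0 < K ∧ ∀ X : ℝ, 1 ≤ X →
    |((TS (X^5)).card : ℝ) - (riemannZeta (3/2)).re * X ^ (5/2 : ℝ) - (riemannZeta (2/3)).re * X ^ (5/3 : ℝ)| ≤ K * X ^ (4/5 : ℝ) := by
  obtain ⟨K1, hK1, hs1⟩ := side (3/2) (by norm_num) (by norm_num) (by norm_num)
  obtain ⟨K2, hK2, hs2⟩ := side (2/3) (by norm_num) (by norm_num) (by norm_num)
  refine ⟨K1 + K2 + 100, by positivity, ?_⟩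
  intro X hX
  have hX0 : 0 < X := by linarith
  have a1 := hs1 X hX
  have a2 := hs2 X hX
  have ct := cardT X hX
  rw [cardS1 X hX, cardS2 X hX] at ct
  have ct' : ((TS (X^5)).card : ℝ) + (⌊X⌋₊:ℝ)^2 = ((∑ n ∈ Finset.range ⌊X⌋₊, ⌊X ^ (1 + 3/2 : ℝ) * ((n:ℝ)+1) ^ (-(3/2) : ℝ)⌋₊ : ℕ) : ℝ) +
    ((∑ n ∈ Finset.range ⌊X⌋₊, ⌊X ^ (1 + 2/3 : ℝ) * ((n:ℝ)+1) ^ (-(2/3) : ℝ)⌋₊ : ℕ) : ℝ) := by exact_mod_cast ct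
  have z1 : (((3/2 : ℝ)) : ℂ) = 3/2 := by push_cast; rfl
  have z2 : (((2/3 : ℝ)) : ℂ) = 2/3 := by push_cast; rfl
  rw [z1] at a1
  rw [z2] at a2
  set y := ⌊X⌋₊ with hy
  have hy1 : 1 ≤ y := Nat.le_floor (by simpa using hX)
  have hy1' : (1:ℝ) ≤ y := by exact_mod_cast hy1
  have hy0 : (0:ℝ) < y := by linarith
  have hyX : (y:ℝ) ≤ X := Nat.floor_le hX0.le
  have hXy : X ≤ y + 1 := (Nat.lt_floor_add_one X).le
  set t := X / y - 1 with ht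
  have ht0 : 0 ≤ t := by rw [ht, sub_nonneg, one_le_div hy0]; exact hyX
  have hty : y * t ≤ 1 := by rw [ht, mul_sub, mul_div_cancel₀ _ hy0.ne']; linarith
  have ht1 : t ≤ 1 := by nlinarith
  have r1 := rho52 (X / y) t (by rw [ht]; ring) ht0 ht1
  have r2 := rho53 (X / y) t (by rw [ht]; ring) ht0 ht1
  have q1 : (1 + 3/2 : ℝ) = 5/2 := by norm_num
  have q2 : (1 + 2/3 : ℝ) = 5/3 := by norm_num
  rw [q1] at a1 ct'
  rw [q2] at a2 ct'
  set S1 := ((∑ n ∈ Finset.range y, ⌊X ^ (5/2 : ℝ) * ((n:ℝ)+1) ^ (-(3/2) : ℝ)⌋₊ : ℕ) : ℝ)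
  set S2 := ((∑ n ∈ Finset.range y, ⌊X ^ (5/3 : ℝ) * ((n:ℝ)+1) ^ (-(2/3) : ℝ)⌋₊ : ℕ) : ℝ)
  set F1 := (X / y) ^ (5/2 : ℝ)
  set F2 := (X / y) ^ (5/3 : ℝ)
  set D1 := F1 - 1 - 5/2 * t with hD1
  set D2 := F2 - 1 - 5/3 * t with hD2
  have f1 : F1 = 1 + 5/2 * t + D1 := by rw [hD1]; ring
  have f2 : F2 = 1 + 5/3 * t + D2 := by rw [hD2]; ring
  rw [f1] at a1
  rw [f2] at a2
  have b1 := abs_le.mp a1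
  have b2 := abs_le.mp a2
  have hX45 : 1 ≤ X ^ (4/5 : ℝ) := Real.one_le_rpow hX (by norm_num)
  have yt0 : 0 ≤ y * t := by positivity
  have yt2 : (y:ℝ)^2 * t^2 ≤ 1 := by rw [← mul_pow]; exact pow_le_one₀ yt0 hty
  have yy : (y:ℝ) ≤ (y:ℝ)^2 := le_self_pow₀ hy1' two_ne_zero
  have g1 : (y:ℝ)^2 * D1 ≤ 8 := by
    calc (y:ℝ)^2 * D1 ≤ (y:ℝ)^2 * (8 * t^2) := mul_le_mul_of_nonneg_left r1.2 (sq_nonneg _)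
      _ = 8 * ((y:ℝ)^2 * t^2) := by ring
      _ ≤ 8 := by linarith only [yt2]
  have g2 : (y:ℝ)^2 * D2 ≤ 8 := by
    calc (y:ℝ)^2 * D2 ≤ (y:ℝ)^2 * (8 * t^2) := mul_le_mul_of_nonneg_left r2.2 (sq_nonneg _)
      _ = 8 * ((y:ℝ)^2 * t^2) := by ring
      _ ≤ 8 := by linarith only [yt2]
  have g1' : 0 ≤ (y:ℝ)^2 * D1 := mul_nonneg (sq_nonneg _) r1.1
  have g2' : 0 ≤ (y:ℝ)^2 * D2 := mul_nonneg (sq_nonneg _) r2.1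
  have k1 : (y:ℝ) * D1 ≤ 8 := (mul_le_mul_of_nonneg_right yy r1.1).trans g1
  have k2 : (y:ℝ) * D2 ≤ 8 := (mul_le_mul_of_nonneg_right yy r2.1).trans g2
  have k1' : 0 ≤ (y:ℝ) * D1 := mul_nonneg hy0.le r1.1
  have k2' : 0 ≤ (y:ℝ) * D2 := mul_nonneg hy0.le r2.1
  have m1 : (y:ℝ)^2 * (1 + 5/2 * t + D1) / (1 - 3/2) + (y:ℝ) * (1 + 5/2 * t + D1) / 2 - (y:ℝ)/2
     = -2 * (y:ℝ)^2 - 5 * ((y:ℝ)^2 * t) - 2 * ((y:ℝ)^2 * D1) + 5/4 * (y * t) + (y * D1) / 2 := by ring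
  have m2 : (y:ℝ)^2 * (1 + 5/3 * t + D2) / (1 - 2/3) + (y:ℝ) * (1 + 5/3 * t + D2) / 2 - (y:ℝ)/2
     = 3 * (y:ℝ)^2 + 5 * ((y:ℝ)^2 * t) + 3 * ((y:ℝ)^2 * D2) + 5/6 * (y * t) + (y * D2) / 2 := by ring
  rw [abs_le]
  constructor
  · linarith [b1.1, b2.1]
  · linarith [b1.2, b2.2]

lemma T_asymp : ∃ K : ℝ, 0 < K ∧ ∀ x : ℝ, 1 ≤ x →
    |((TS x).card : ℝ) - (riemannZeta (3/2)).re * x ^ (1/2 : ℝ) - (riemannZeta (2/3)).re * x ^ (1/3 : ℝ)| ≤ K * x ^ (4/25 : ℝ) := by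
  obtain ⟨K, hK, h⟩ := T_asymp_X
  refine ⟨K, hK, fun x hx => ?_⟩
  have hx0 : 0 ≤ x := by linarith
  have := h (x ^ (1/5 : ℝ)) (Real.one_le_rpow hx (by norm_num))
  have e : (x ^ (1/5 : ℝ)) ^ 5 = x := by rw [← Real.rpow_natCast, ← Real.rpow_mul hx0]; norm_num
  rw [e, ← Real.rpow_mul hx0, ← Real.rpow_mul hx0, ← Real.rpow_mul hx0] at this
  norm_num at this ⊢
  exact this

lemma sq_dvd_sqf {b c d : ℕ} (hb : Squarefree b) (h : d ^ 2 ∣ c ^ 2 * b) : d ∣ c := by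
  rcases Nat.eq_zero_or_pos c with rfl | hc
  · simp
  have hg : 0 < Nat.gcd d c := Nat.gcd_pos_of_pos_right _ hc
  obtain ⟨d', c', hcop, hd, hc'⟩ := Nat.exists_coprime d c
  set g := Nat.gcd d c with hgdef
  have h1 : d' ^ 2 * g ^ 2 ∣ c' ^ 2 * b * g ^ 2 := by
    rw [← mul_pow, ← hd]
    have : c ^ 2 * b = c' ^ 2 * b * g ^ 2 := by
      conv_lhs => rw [hc']
      ring
    rwa [← this]
  have h2 : d' ^ 2 ∣ c' ^ 2 * b := Nat.dvd_of_mul_dvd_mul_right (by positivity) h1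
  have h3 : d' ^ 2 ∣ b := (Nat.Coprime.pow 2 2 hcop).dvd_of_dvd_mul_left h2
  have h4 : IsUnit d' := hb d' (by rwa [← sq])
  rw [Nat.isUnit_iff] at h4
  rw [h4, one_mul] at hd
  rw [hd]
  exact Nat.gcd_dvd_right d c

lemma powerful_exists {n : ℕ} (hn : IsPowerful n) : ∃ a b : ℕ, 1 ≤ a ∧ 1 ≤ b ∧ Squarefree b ∧ a ^ 2 * b ^ 3 = n := by
  obtain ⟨b, c, hcb, hb⟩ := Nat.sq_mul_squarefree n
  obtain ⟨hn0, hp⟩ := hn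
  have hb0 : b ≠ 0 := hb.ne_zero
  have hc0 : c ≠ 0 := by rintro rfl; simp at hcb; omega
  have hdvd : b ∣ c := by
    rw [← Nat.prod_primeFactors_of_squarefree hb]
    refine (Finset.prod_dvd_prod_of_subset _ _ _ ?_).trans (Nat.prod_primeFactors_dvd c)
    intro p hpb
    have pp := Nat.prime_of_mem_primeFactors hpb
    have pd := Nat.dvd_of_mem_primeFactors hpb
    refine Nat.mem_primeFactors.2 ⟨pp, sq_dvd_sqf hb ?_, hc0⟩
    rw [hcb]
    exact hp p pp (by rw [← hcb]; exact pd.mul_left _)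
  obtain ⟨a, rfl⟩ := hdvd
  refine ⟨a, b, ?_, by omega, hb, by rw [← hcb]; ring⟩
  rcases Nat.eq_zero_or_pos a with rfl | h
  · simp at hc0
  · exact h

lemma powerful_of {a b : ℕ} (ha : 1 ≤ a) (hb : 1 ≤ b) : IsPowerful (a ^ 2 * b ^ 3) := by
  refine ⟨by positivity, fun p hp h => ?_⟩
  rcases (Nat.Prime.dvd_mul hp).1 h with h | h
  · exact (pow_dvd_pow_of_dvd (hp.dvd_of_dvd_pow h) 2).mul_right _
  · exact Dvd.dvd.mul_left ((pow_dvd_pow_of_dvd (hp.dvd_of_dvd_pow h) 2).trans (pow_dvd_pow b (by norm_num))) _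

lemma powerful_uniq {a b a' b' : ℕ} (ha : 1 ≤ a) (hb : 1 ≤ b) (sb : Squarefree b) (ha' : 1 ≤ a') (hb' : 1 ≤ b') (sb' : Squarefree b')
    (h : a ^ 2 * b ^ 3 = a' ^ 2 * b' ^ 3) : a = a' ∧ b = b' := by
  have e1 : a ^ 2 * b ^ 3 = (a * b) ^ 2 * b := by ring
  have e2 : a' ^ 2 * b' ^ 3 = (a' * b') ^ 2 * b' := by ring
  have d1 : a * b ∣ a' * b' := sq_dvd_sqf sb' (by rw [← e2, ← h, e1]; exact dvd_mul_right _ _)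
  have d2 : a' * b' ∣ a * b := sq_dvd_sqf sb (by rw [← e1, h, e2]; exact dvd_mul_right _ _)
  have e := Nat.dvd_antisymm d1 d2
  rw [e1, e2, e] at h
  have hbb : b = b' := Nat.eq_of_mul_eq_mul_left (by positivity) h
  subst hbb
  exact ⟨Nat.eq_of_mul_eq_mul_right (by omega) e, rfl⟩

lemma powerful_count (x : ℝ) : {n : ℕ | IsPowerful n ∧ (n : ℝ) ≤ x}.ncard = ((TS x).filter (fun p => Squarefree p.2)).card := by
  have : {n : ℕ | IsPowerful n ∧ (n : ℝ) ≤ x} = (((TS x).filter (fun p => Squarefree p.2)).image (fun p => p.1 ^ 2 * p.2 ^ 3) : Finset ℕ) := by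
    ext n
    simp only [Set.mem_ofPred_eq, Finset.coe_image, Set.mem_image, Finset.mem_coe, Finset.mem_filter, mem_TS]
    constructor
    · rintro ⟨h1, h2⟩
      obtain ⟨a, b, ha, hb, sb, rfl⟩ := powerful_exists h1
      exact ⟨(a, b), ⟨⟨ha, hb, by exact_mod_cast h2⟩, sb⟩, rfl⟩
    · rintro ⟨p, ⟨⟨h1, h2, h3⟩, h4⟩, rfl⟩
      exact ⟨powerful_of h1 h2, by exact_mod_cast h3⟩
  rw [this, Set.ncard_coe_finset, Finset.card_image_of_injOn]
  rintro ⟨a, b⟩ h ⟨a', b'⟩ h' e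
  simp only [Finset.mem_coe, Finset.mem_filter, mem_TS] at h h'
  obtain ⟨r1, r2⟩ := powerful_uniq h.1.1 h.1.2.1 h.2 h'.1.1 h'.1.2.1 h'.2 e
  rw [r1, r2]

lemma sum_mu_sq (b D : ℕ) (hb : 1 ≤ b) (hD : ∀ d : ℕ, d ^ 2 ∣ b → d ≤ D) :
    (∑ d ∈ Finset.Icc 1 D, if d ^ 2 ∣ b then ArithmeticFunction.moebius d else 0) = if Squarefree b then 1 else 0 := by
  obtain ⟨b', c, hcb, sb⟩ := Nat.sq_mul_squarefree b
  have hc0 : c ≠ 0 := by rintro rfl; simp at hcb; omega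
  have key : ∀ d, d ^ 2 ∣ b ↔ d ∣ c := by
    intro d
    constructor
    · intro h; rw [← hcb] at h; exact sq_dvd_sqf sb h
    · intro h; rw [← hcb]; exact (pow_dvd_pow_of_dvd h 2).mul_right _
  have : (Finset.Icc 1 D).filter (fun d => d ^ 2 ∣ b) = c.divisors := by
    ext d
    simp only [Finset.mem_filter, Finset.mem_Icc, Nat.mem_divisors, key]
    constructor
    · rintro ⟨_, h⟩; exact ⟨h, hc0⟩
    · rintro ⟨h, _⟩
      exact ⟨⟨Nat.pos_of_dvd_of_pos h (Nat.pos_of_ne_zero hc0), hD d ((key d).2 h)⟩, h⟩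
  rw [← Finset.sum_filter, this, ← ArithmeticFunction.coe_zeta_mul_apply, ArithmeticFunction.coe_zeta_mul_moebius, ArithmeticFunction.one_apply]
  have : Squarefree b ↔ c = 1 := by
    constructor
    · intro h; exact Nat.isUnit_iff.1 (h c (by rw [← hcb, sq]; exact dvd_mul_right _ _))
    · rintro rfl; rw [← hcb]; simpa using sb
  simp [this]

lemma card_dvd (x : ℝ) (d : ℕ) (hd : 1 ≤ d) : ((TS x).filter (fun p => d ^ 2 ∣ p.2)).card = (TS (x / (d:ℝ) ^ 6)).card := by
  symm
  have hd0 : (0:ℝ) < d := by exact_mod_cast hd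
  apply Finset.card_bij (fun p _ => (p.1, d ^ 2 * p.2))
  · intro p hp
    rw [mem_TS, le_div_iff₀ (by positivity)] at hp
    simp only [Finset.mem_filter, mem_TS]
    refine ⟨⟨hp.1, ?_, ?_⟩, dvd_mul_right _ _⟩
    · have := hp.2.1
      exact Nat.mul_pos (by positivity) this
    · push_cast
      calc _ = (p.1:ℝ) ^ 2 * (p.2:ℝ) ^ 3 * (d:ℝ) ^ 6 := by ring
        _ ≤ x := hp.2.2
  · rintro ⟨a, b⟩ _ ⟨a', b'⟩ _ h
    simp only [Prod.mk.injEq] at h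
    obtain ⟨h1, h2⟩ := h
    rw [h1, Nat.eq_of_mul_eq_mul_left (by positivity) h2]
  · rintro ⟨a, b⟩ h
    simp only [Finset.mem_filter, mem_TS] at h
    obtain ⟨⟨h1, h2, h3⟩, ⟨b', rfl⟩⟩ := h
    refine ⟨(a, b'), ?_, rfl⟩
    rw [mem_TS, le_div_iff₀ (by positivity)]
    refine ⟨h1, Nat.pos_of_mul_pos_left h2, ?_⟩
    push_cast at h3
    calc _ = (a:ℝ) ^ 2 * ((d:ℝ) ^ 2 * (b':ℝ)) ^ 3 := by ring
      _ ≤ x := h3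

lemma powerful_sum (x : ℝ) (D : ℕ) (hD : ∀ d : ℕ, (d:ℝ) ^ 6 ≤ x → d ≤ D) :
    ({n : ℕ | IsPowerful n ∧ (n : ℝ) ≤ x}.ncard : ℤ) =
      ∑ d ∈ Finset.Icc 1 D, ArithmeticFunction.moebius d * ((TS (x / (d:ℝ) ^ 6)).card : ℤ) := by
  rw [powerful_count, Finset.card_filter]
  push_cast
  have : ∀ p ∈ TS x, (if Squarefree p.2 then (1:ℤ) else 0) = ∑ d ∈ Finset.Icc 1 D, if d ^ 2 ∣ p.2 then ArithmeticFunction.moebius d else 0 := by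
    intro p hp
    rw [mem_TS] at hp
    rw [sum_mu_sq _ _ hp.2.1]
    intro d hd
    apply hD
    have h1 : d ^ 2 ≤ p.2 := Nat.le_of_dvd hp.2.1 hd
    have h2 : (d:ℝ) ^ 2 ≤ p.2 := by exact_mod_cast h1
    have h3 : (1:ℝ) ≤ p.1 := by exact_mod_cast hp.1
    calc (d:ℝ) ^ 6 = 1 ^ 2 * ((d:ℝ) ^ 2) ^ 3 := by ring
      _ ≤ (p.1:ℝ) ^ 2 * (p.2:ℝ) ^ 3 := by gcongr
      _ ≤ x := hp.2.2
  rw [Finset.sum_congr rfl this, Finset.sum_comm]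
  refine Finset.sum_congr rfl fun d hd => ?_
  rw [← card_dvd x d (Finset.mem_Icc.1 hd).1, ← Finset.sum_filter, Finset.sum_const, nsmul_eq_mul, mul_comm]

lemma mob_sum (k : ℕ) (hk : 2 ≤ k) : ∃ M : ℝ, (1 / riemannZeta (k:ℂ)) = (M:ℂ) ∧
    HasSum (fun d : ℕ => (ArithmeticFunction.moebius d : ℝ) / (d:ℝ) ^ k) M := by
  have hs : 1 < ((k:ℂ)).re := by simp; omega
  have hsum := ArithmeticFunction.LSeriesSummable_moebius_iff.2 hs
  have hmul := ArithmeticFunction.LSeries_zeta_mul_Lseries_moebius hs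
  rw [ArithmeticFunction.LSeries_zeta_eq_riemannZeta hs] at hmul
  have hterm : ∀ d : ℕ, LSeries.term (fun n => ((ArithmeticFunction.moebius n : ℤ) : ℂ)) (k:ℂ) d =
      (((ArithmeticFunction.moebius d : ℝ) / (d:ℝ) ^ k : ℝ) : ℂ) := by
    intro d
    rcases Nat.eq_zero_or_pos d with rfl | hd
    · simp
    · rw [LSeries.term_of_ne_zero hd.ne']
      push_cast
      rw [Complex.cpow_natCast]
  have h1 : HasSum (fun d : ℕ => (((ArithmeticFunction.moebius d : ℝ) / (d:ℝ) ^ k : ℝ) : ℂ))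
      (LSeries (fun n => ((ArithmeticFunction.moebius n : ℤ) : ℂ)) (k:ℂ)) := by
    rw [← funext hterm]
    exact hsum.hasSum
  have h2 : Summable (fun d : ℕ => (ArithmeticFunction.moebius d : ℝ) / (d:ℝ) ^ k) :=
    Complex.summable_ofReal.1 h1.summable
  refine ⟨_, ?_, h2.hasSum⟩
  have h3 := (Complex.hasSum_ofReal.2 h2.hasSum).unique h1
  rw [h3]
  have hz : riemannZeta (k:ℂ) ≠ 0 := left_ne_zero_of_mul (by rw [hmul]; exact one_ne_zero)
  rw [div_eq_iff hz, mul_comm]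
  exact hmul.symm

lemma mu_abs (d : ℕ) : |(ArithmeticFunction.moebius d : ℝ)| ≤ 1 := by
  exact_mod_cast (ArithmeticFunction.abs_moebius_le_one (n := d))

lemma mob_tail (k : ℕ) (M : ℝ) (D : ℕ) (hD : 1 ≤ D)
    (h : HasSum (fun d : ℕ => (ArithmeticFunction.moebius d : ℝ) / (d:ℝ) ^ (k+2)) M) :
    |M - ∑ d ∈ Finset.Icc 1 D, (ArithmeticFunction.moebius d : ℝ) / (d:ℝ) ^ (k+2)| ≤ 1 / (D:ℝ) ^ (k+1) := by
  set f := (fun d : ℕ => (ArithmeticFunction.moebius d : ℝ) / (d:ℝ) ^ (k+2)) with hf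
  have hD0 : (1:ℝ) ≤ D := by exact_mod_cast hD
  have e : ∑ d ∈ Finset.Icc 1 D, f d = ∑ d ∈ Finset.range (D+1), f d := by
    rw [Finset.range_eq_Ico, Finset.sum_eq_sum_Ico_succ_bot (by omega)]
    have : f 0 = 0 := by simp [hf]
    rw [this, zero_add]
    rfl
  have step : ∀ N : ℕ, D ≤ N → |∑ d ∈ Finset.range (N+1), f d - ∑ d ∈ Finset.range (D+1), f d| ≤
      (1 / (D:ℝ) - 1 / N) * (1 / (D:ℝ) ^ k) := by
    intro N hN
    induction N, hN using Nat.le_induction with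
    | base => simp
    | succ N hN ih =>
      rw [Finset.sum_range_succ]
      have hN0 : (1:ℝ) ≤ N := le_trans hD0 (by exact_mod_cast hN)
      have hDN : (D:ℝ) ≤ N := by exact_mod_cast hN
      have h1 : |f (N+1)| ≤ (1 / (N:ℝ) - 1 / ((N:ℝ)+1)) * (1 / (D:ℝ) ^ k) := by
        simp only [hf]
        push_cast
        rw [abs_div, abs_of_pos (by positivity : (0:ℝ) < ((N:ℝ)+1) ^ (k+2))]
        calc _ ≤ 1 / ((N:ℝ)+1) ^ (k+2) := by gcongr; exact mu_abs _
          _ = 1 / ((N:ℝ)+1) ^ 2 * (1 / ((N:ℝ)+1) ^ k) := by rw [pow_add]; field_simp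
          _ ≤ (1 / (N:ℝ) - 1 / ((N:ℝ)+1)) * (1 / (D:ℝ) ^ k) := by
            have q1 : 1 / ((N:ℝ)+1) ^ 2 ≤ 1 / (N:ℝ) - 1 / ((N:ℝ)+1) := by
              rw [div_sub_div _ _ (by positivity) (by positivity), div_le_div_iff₀ (by positivity) (by positivity)]
              nlinarith
            have q2 : 1 / ((N:ℝ)+1) ^ k ≤ 1 / (D:ℝ) ^ k := by
              gcongr
              linarith
            exact mul_le_mul q1 q2 (by positivity) (le_trans (by positivity) q1)
      calc |∑ d ∈ Finset.range (N+1), f d + f (N+1) - ∑ d ∈ Finset.range (D+1), f d|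
          = |(∑ d ∈ Finset.range (N+1), f d - ∑ d ∈ Finset.range (D+1), f d) + f (N+1)| := by congr 1; ring
        _ ≤ _ := abs_add_le _ _
        _ ≤ _ := add_le_add ih h1
        _ = _ := by push_cast; ring
  rw [e]
  have lim : Tendsto (fun N => |∑ d ∈ Finset.range (N+1), f d - ∑ d ∈ Finset.range (D+1), f d|) atTop
      (𝓝 |M - ∑ d ∈ Finset.range (D+1), f d|) :=
    (((tendsto_add_atTop_iff_nat 1).2 h.tendsto_sum_nat).sub_const _).abs
  refine le_of_tendsto lim ?_
  filter_upwards [eventually_ge_atTop D] with N hN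
  refine (step N hN).trans ?_
  calc (1 / (D:ℝ) - 1 / N) * (1 / (D:ℝ) ^ k) ≤ (1 / (D:ℝ)) * (1 / (D:ℝ) ^ k) := by
        gcongr
        have : (0:ℝ) ≤ 1 / N := by positivity
        linarith
    _ = _ := by rw [pow_succ]; field_simp

lemma sum_2425 (D : ℕ) : ∑ d ∈ Finset.Icc 1 D, (d:ℝ) ^ (-(24/25) : ℝ) ≤ 25 * (D:ℝ) ^ (1/25 : ℝ) := by
  induction D with
  | zero => simp
  | succ n ih =>
    rw [Finset.sum_Icc_succ_top (by omega)]
    have hn : (0:ℝ) < (n:ℝ) + 1 := by positivity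
    have h1 : (n:ℝ) ^ (1/25 : ℝ) ≤ ((n:ℝ)+1) ^ (1/25 : ℝ) - 1/25 * ((n:ℝ)+1) ^ (-(24/25) : ℝ) := by
      have hu : (n:ℝ) = (n+1) * (1 + -(1/((n:ℝ)+1))) := by field_simp; ring
      have hu1 : 1/((n:ℝ)+1) ≤ 1 := by
        rw [div_le_one hn]
        have : (0:ℝ) ≤ n := Nat.cast_nonneg n
        linarith
      have b := rpow_one_add_le_one_add_mul_self (s := -(1/((n:ℝ)+1))) (by linarith) (p := 1/25) (by norm_num) (by norm_num)
      have e : ((n:ℝ)+1) ^ (1/25 : ℝ) * (1/((n:ℝ)+1)) = ((n:ℝ)+1) ^ (-(24/25) : ℝ) := by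
        rw [mul_one_div, ← Real.rpow_sub_one hn.ne']; norm_num
      calc (n:ℝ) ^ (1/25 : ℝ) = ((n:ℝ)+1) ^ (1/25 : ℝ) * (1 + -(1/((n:ℝ)+1))) ^ (1/25 : ℝ) := by
            rw [← Real.mul_rpow hn.le (by linarith), ← hu]
        _ ≤ ((n:ℝ)+1) ^ (1/25 : ℝ) * (1 + 1/25 * (-(1/((n:ℝ)+1)))) := by gcongr
        _ = ((n:ℝ)+1) ^ (1/25 : ℝ) - 1/25 * (((n:ℝ)+1) ^ (1/25 : ℝ) * (1/((n:ℝ)+1))) := by ring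
        _ = _ := by rw [e]
    push_cast
    linarith

lemma final_z : ∃ C : ℝ, 0 < C ∧ ∀ z : ℝ, 1 ≤ z →
      |({n : ℕ | IsPowerful n ∧ (n : ℝ) ≤ z ^ 6}.ncard : ℝ) -
        (riemannZeta (3 / 2) / riemannZeta 3).re * z ^ 3 -
        (riemannZeta (2 / 3) / riemannZeta 2).re * z ^ 2| ≤ C * z := by
  obtain ⟨K, hK, hT⟩ := T_asymp
  obtain ⟨M3, hM3, hs3⟩ := mob_sum 3 (by norm_num)
  obtain ⟨M2, hM2, hs2⟩ := mob_sum 2 (by norm_num)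
  set α := (riemannZeta (3/2)).re with hα
  set β := (riemannZeta (2/3)).re with hβ
  have c3 : (riemannZeta (3 / 2) / riemannZeta 3).re = α * M3 := by
    push_cast at hM3
    rw [div_eq_mul_one_div, hM3, Complex.re_mul_ofReal]
  have c2 : (riemannZeta (2 / 3) / riemannZeta 2).re = β * M2 := by
    push_cast at hM2
    rw [div_eq_mul_one_div, hM2, Complex.re_mul_ofReal]
  rw [c3, c2]
  refine ⟨25 * K + 4 * |α| + 2 * |β|, by positivity, ?_⟩
  intro z hz
  have hz0 : 0 < z := by linarith
  set D := ⌊z⌋₊ with hDdef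
  have hD1 : 1 ≤ D := Nat.le_floor (by simpa using hz)
  have hD1' : (1:ℝ) ≤ D := by exact_mod_cast hD1
  have hDz : (D:ℝ) ≤ z := Nat.floor_le hz0.le
  have hzD : z ≤ 2 * D := by linarith [Nat.lt_floor_add_one z]
  have hps := powerful_sum (z ^ 6) D (by
    intro d hd
    apply Nat.le_floor
    exact le_of_pow_le_pow_left₀ (by norm_num) hz0.le hd)
  have hps' : ({n : ℕ | IsPowerful n ∧ (n : ℝ) ≤ z ^ 6}.ncard : ℝ) =
      ∑ d ∈ Finset.Icc 1 D, (ArithmeticFunction.moebius d : ℝ) * ((TS (z ^ 6 / (d:ℝ) ^ 6)).card : ℝ) := by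
    exact_mod_cast hps
  have t3 := mob_tail 1 M3 D hD1 hs3
  have t2 := mob_tail 0 M2 D hD1 hs2
  simp only [Nat.reduceAdd] at t3 t2
  set S3 := ∑ d ∈ Finset.Icc 1 D, (ArithmeticFunction.moebius d : ℝ) / (d:ℝ) ^ 3 with hS3
  set S2 := ∑ d ∈ Finset.Icc 1 D, (ArithmeticFunction.moebius d : ℝ) / (d:ℝ) ^ 2 with hS2
  have main : |({n : ℕ | IsPowerful n ∧ (n : ℝ) ≤ z ^ 6}.ncard : ℝ) - α * z ^ 3 * S3 - β * z ^ 2 * S2| ≤ 25 * K * z := by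
    rw [hps', hS3, hS2, Finset.mul_sum, Finset.mul_sum, ← Finset.sum_sub_distrib, ← Finset.sum_sub_distrib]
    refine (Finset.abs_sum_le_sum_abs _ _).trans ?_
    have bd : ∀ d ∈ Finset.Icc 1 D, |(ArithmeticFunction.moebius d : ℝ) * ((TS (z ^ 6 / (d:ℝ) ^ 6)).card : ℝ)
        - α * z ^ 3 * ((ArithmeticFunction.moebius d : ℝ) / (d:ℝ) ^ 3) - β * z ^ 2 * ((ArithmeticFunction.moebius d : ℝ) / (d:ℝ) ^ 2)|
        ≤ K * z ^ (24/25 : ℝ) * (d:ℝ) ^ (-(24/25) : ℝ) := by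
      intro d hd
      rw [Finset.mem_Icc] at hd
      have hd0 : (0:ℝ) < d := by exact_mod_cast hd.1
      have hdz : (d:ℝ) ≤ z := le_trans (by exact_mod_cast hd.2) hDz
      set w := z / d with hw
      have hw1 : 1 ≤ w := (one_le_div hd0).2 hdz
      have hw0 : 0 ≤ w := by linarith
      have := hT (w ^ 6) (one_le_pow₀ hw1)
      have r1 : (w ^ 6) ^ (1/2 : ℝ) = w ^ 3 := by
        rw [← Real.rpow_natCast, ← Real.rpow_natCast, ← Real.rpow_mul hw0]; norm_num
      have r2 : (w ^ 6) ^ (1/3 : ℝ) = w ^ 2 := by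
        rw [← Real.rpow_natCast, ← Real.rpow_natCast, ← Real.rpow_mul hw0]; norm_num
      have r3 : (w ^ 6) ^ (4/25 : ℝ) = z ^ (24/25 : ℝ) * (d:ℝ) ^ (-(24/25) : ℝ) := by
        rw [← Real.rpow_natCast, ← Real.rpow_mul hw0, hw, Real.div_rpow hz0.le hd0.le, Real.rpow_neg hd0.le, div_eq_mul_inv]
        norm_num
      rw [r1, r2, r3] at this
      rw [← div_pow]
      have e : (ArithmeticFunction.moebius d : ℝ) * ((TS (w ^ 6)).card : ℝ)
        - α * z ^ 3 * ((ArithmeticFunction.moebius d : ℝ) / (d:ℝ) ^ 3) - β * z ^ 2 * ((ArithmeticFunction.moebius d : ℝ) / (d:ℝ) ^ 2)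
        = (ArithmeticFunction.moebius d : ℝ) * (((TS (w ^ 6)).card : ℝ) - α * w ^ 3 - β * w ^ 2) := by
        rw [hw]; ring
      rw [e, abs_mul, mul_assoc K]
      exact (mul_le_of_le_one_left (abs_nonneg _) (mu_abs d)).trans this
    refine (Finset.sum_le_sum bd).trans ?_
    rw [← Finset.mul_sum]
    calc K * z ^ (24/25 : ℝ) * ∑ d ∈ Finset.Icc 1 D, (d:ℝ) ^ (-(24/25) : ℝ)
        ≤ K * z ^ (24/25 : ℝ) * (25 * z ^ (1/25 : ℝ)) := by
          gcongr
          refine (sum_2425 D).trans ?_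
          gcongr
      _ = 25 * K * (z ^ (24/25 : ℝ) * z ^ (1/25 : ℝ)) := by ring
      _ = 25 * K * z := by rw [← Real.rpow_add hz0]; norm_num
  have u3 : |α * z ^ 3 * (M3 - S3)| ≤ 4 * |α| * z := by
    rw [abs_mul, abs_mul, abs_of_pos (by positivity : (0:ℝ) < z ^ 3)]
    have h4 : z ^ 2 * (1 / (D:ℝ) ^ 2) ≤ 4 := by
      rw [mul_one_div, div_le_iff₀ (by positivity)]
      nlinarith
    calc |α| * z ^ 3 * |M3 - S3| ≤ |α| * z ^ 3 * (1 / (D:ℝ) ^ 2) := by gcongr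
      _ = |α| * z * (z ^ 2 * (1 / (D:ℝ) ^ 2)) := by ring
      _ ≤ |α| * z * 4 := by gcongr
      _ = _ := by ring
  have u2 : |β * z ^ 2 * (M2 - S2)| ≤ 2 * |β| * z := by
    rw [abs_mul, abs_mul, abs_of_pos (by positivity : (0:ℝ) < z ^ 2)]
    have h4 : z * (1 / (D:ℝ) ^ 1) ≤ 2 := by
      rw [mul_one_div, div_le_iff₀ (by positivity), pow_one]
      exact hzD
    calc |β| * z ^ 2 * |M2 - S2| ≤ |β| * z ^ 2 * (1 / (D:ℝ) ^ 1) := by gcongr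
      _ = |β| * z * (z * (1 / (D:ℝ) ^ 1)) := by ring
      _ ≤ |β| * z * 2 := by gcongr
      _ = _ := by ring
  have a1 := abs_le.1 main
  have a2 := abs_le.1 u3
  have a3 := abs_le.1 u2
  rw [abs_le]
  constructor
  · linarith [a1.1, a2.2, a3.2]
  · linarith [a1.2, a2.1, a3.1]

end Aux

open Real in
theorem stmt_15 :
    ∃ C : ℝ, 0 < C ∧ ∀ x : ℝ, 2 ≤ x →
      |({n : ℕ | IsPowerful n ∧ (n : ℝ) ≤ x}.ncard : ℝ) -
        (riemannZeta (3 / 2) / riemannZeta 3).re * x ^ ((1 : ℝ) / 2) -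
        (riemannZeta (2 / 3) / riemannZeta 2).re * x ^ ((1 : ℝ) / 3)|
      ≤ C * x ^ ((1 : ℝ) / 6) := by
  obtain ⟨C, hC, h⟩ := final_z
  refine ⟨C, hC, fun x hx => ?_⟩
  have hx0 : 0 ≤ x := by linarith
  have := h (x ^ ((1:ℝ)/6)) (Real.one_le_rpow (by linarith) (by norm_num))
  have e6 : (x ^ ((1:ℝ)/6)) ^ 6 = x := by rw [← Real.rpow_natCast, ← Real.rpow_mul hx0]; norm_num
  have e3 : (x ^ ((1:ℝ)/6)) ^ 3 = x ^ ((1:ℝ)/2) := by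
    rw [← Real.rpow_natCast, ← Real.rpow_mul hx0]; norm_num
  have e2 : (x ^ ((1:ℝ)/6)) ^ 2 = x ^ ((1:ℝ)/3) := by
    rw [← Real.rpow_natCast, ← Real.rpow_mul hx0]; norm_num
  rw [e6, e3, e2] at this
  exact this
end

section
/- If A = (S₁, S₂, ...) is a sequence of sets of positive integers each containing 1, then the set of positive integers N such that for every n, if the n-th prime pₙ divides N then its exponent in N lies in Sₙ, has natural density ∏_{n≥1} (1 + ∑_{i≥2} (uₙ(i) − uₙ(i−1))/pₙ^i), where uₙ is the characteristic function of Sₙ. -/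
def HasDensity (A : Set ℕ) (d : ℝ) : Prop :=
  Filter.Tendsto (fun N : ℕ => ({n : ℕ | n ∈ A ∧ n ≤ N}.ncard : ℝ) / N)
    Filter.atTop (nhds d)

/-- `prime n` is the `n`-th prime, `1`-indexed: `prime 1 = 2`. -/
noncomputable def nthPrime (n : ℕ) : ℕ := Nat.nth Nat.Prime (n - 1)

/-- `N` is an exponentially `A`-number for the sequence of sets `Sseq` (1-indexed):
whenever the `n`-th prime divides `N`, its exponent lies in `Sseq n`. -/
def IsExpANumber (Sseq : ℕ → Set ℕ) (N : ℕ) : Prop :=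
  0 < N ∧ ∀ n : ℕ, 1 ≤ n → nthPrime n ∣ N → N.factorization (nthPrime n) ∈ Sseq n

open ArithmeticFunction in
open Classical in
noncomputable def eF (T : ℕ → Set ℕ) : ArithmeticFunction ℝ :=
  ⟨fun N => if 0 < N ∧ ∀ p, p.Prime → p ∣ N → N.factorization p ∈ T p then 1 else 0, by simp⟩

lemma eF_apply (T : ℕ → Set ℕ) (N : ℕ) [Decidable (0 < N ∧ ∀ p, p.Prime → p ∣ N → N.factorization p ∈ T p)] :
    eF T N = if 0 < N ∧ ∀ p, p.Prime → p ∣ N → N.factorization p ∈ T p then 1 else 0 := by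
  simp only [eF, ArithmeticFunction.coe_mk]
  congr

lemma eF_mult (T : ℕ → Set ℕ) : (eF T).IsMultiplicative := by
  classical
  rw [ArithmeticFunction.IsMultiplicative.iff_ne_zero]
  constructor
  · rw [eF_apply, if_pos]
    refine ⟨one_pos, fun p hp h => ?_⟩
    exact absurd (Nat.dvd_one.mp h) hp.one_lt.ne'
  · intro m n hm hn hmn
    have key : (∀ p, p.Prime → p ∣ m * n → (m * n).factorization p ∈ T p) ↔
        (∀ p, p.Prime → p ∣ m → m.factorization p ∈ T p) ∧
        (∀ p, p.Prime → p ∣ n → n.factorization p ∈ T p) := by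
      have hL : ∀ p, p.Prime → p ∣ m → (m * n).factorization p = m.factorization p := by
        intro p hp h
        have : ¬ p ∣ n := fun h' => hp.one_lt.ne' (Nat.dvd_one.mp (hmn ▸ Nat.dvd_gcd h h'))
        rw [Nat.factorization_mul hm hn]
        simp [Nat.factorization_eq_zero_of_not_dvd this]
      have hR : ∀ p, p.Prime → p ∣ n → (m * n).factorization p = n.factorization p := by
        intro p hp h
        have : ¬ p ∣ m := fun h' => hp.one_lt.ne' (Nat.dvd_one.mp (hmn ▸ Nat.dvd_gcd h' h))
        rw [Nat.factorization_mul hm hn]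
        simp [Nat.factorization_eq_zero_of_not_dvd this]
      constructor
      · intro h
        exact ⟨fun p hp hd => hL p hp hd ▸ h p hp (hd.mul_right n),
          fun p hp hd => hR p hp hd ▸ h p hp (hd.mul_left m)⟩
      · rintro ⟨h, h'⟩ p hp hd
        rcases (hp.dvd_mul).mp hd with h2 | h2
        · rw [hL p hp h2]; exact h p hp h2
        · rw [hR p hp h2]; exact h' p hp h2
    simp only [eF_apply, key, Nat.pos_of_ne_zero hm, Nat.pos_of_ne_zero hn,
      Nat.pos_of_ne_zero (mul_ne_zero hm hn), true_and]
    by_cases hA : ∀ p, p.Prime → p ∣ m → m.factorization p ∈ T p <;>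
    by_cases hB : ∀ p, p.Prime → p ∣ n → n.factorization p ∈ T p
    · rw [if_pos ⟨hA, hB⟩, if_pos hA, if_pos hB, mul_one]
    · rw [if_neg (fun h => hB h.2), if_neg hB, mul_zero]
    · rw [if_neg (fun h => hA h.1), if_neg hA, zero_mul]
    · rw [if_neg (fun h => hA h.1), if_neg hA, zero_mul]

lemma eF_prime_pow (T : ℕ → Set ℕ) {p : ℕ} (hp : p.Prime) (k : ℕ) :
    eF T (p ^ (k + 1)) = (T p).indicator (fun _ => (1 : ℝ)) (k + 1) := by
  classical
  rw [eF_apply, Set.indicator_apply]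
  congr 1
  apply propext
  constructor
  · intro h
    have := h.2 p hp (dvd_pow_self p (Nat.succ_ne_zero k))
    simpa [hp.factorization_self, Nat.factorization_pow] using this
  · intro h
    refine ⟨pow_pos hp.pos _, fun q hq hd => ?_⟩
    have : q = p := (Nat.prime_dvd_prime_iff_eq hq hp).mp (hq.dvd_of_dvd_pow hd)
    subst this
    simpa [hp.factorization_self, Nat.factorization_pow] using h

noncomputable def eG (T : ℕ → Set ℕ) : ArithmeticFunction ℝ :=
  eF T * ((ArithmeticFunction.moebius : ArithmeticFunction ℤ) : ArithmeticFunction ℝ)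

lemma eG_mul_zeta (T : ℕ → Set ℕ) :
    eG T * ((ArithmeticFunction.zeta : ArithmeticFunction ℕ) : ArithmeticFunction ℝ) = eF T := by
  rw [eG, mul_assoc, ArithmeticFunction.coe_moebius_mul_coe_zeta, mul_one]

lemma eG_mult (T : ℕ → Set ℕ) : (eG T).IsMultiplicative :=
  (eF_mult T).mul ArithmeticFunction.isMultiplicative_moebius.intCast

lemma eG_prime_pow (T : ℕ → Set ℕ) {p : ℕ} (hp : p.Prime) (k : ℕ) :
    eG T (p ^ (k + 1)) = eF T (p ^ (k + 1)) - eF T (p ^ k) := by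
  have h : ∀ k, eF T (p ^ k) = ∑ i ∈ Finset.range (k + 1), eG T (p ^ i) := by
    intro k
    rw [← eG_mul_zeta T, ArithmeticFunction.coe_mul_zeta_apply, Nat.sum_divisors_prime_pow hp]
  rw [h, h, Finset.sum_range_succ _ (k + 1)]
  ring

lemma eF_mem (T : ℕ → Set ℕ) (n : ℕ) : 0 ≤ eF T n ∧ eF T n ≤ 1 := by
  classical
  rw [eF_apply]; split_ifs <;> norm_num

lemma eG_prime (T : ℕ → Set ℕ) {p : ℕ} (hp : p.Prime) (h1 : 1 ∈ T p) : eG T (p ^ 1) = 0 := by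
  have := eG_prime_pow T hp 0
  rw [eF_prime_pow T hp, pow_zero, (eF_mult T).map_one] at this
  simpa [h1] using this

lemma eG_abs_le (T : ℕ → Set ℕ) (n : ℕ) : |eG T n| ≤ 1 := by
  rcases eq_or_ne n 0 with rfl | hn
  · simp
  rw [(eG_mult T).multiplicative_factorization _ hn, Finsupp.prod, Finset.abs_prod]
  apply Finset.prod_le_one
  · intros; positivity
  · intro p hp
    have hp' : p.Prime := Nat.prime_of_mem_primeFactors (by simpa using hp)
    obtain ⟨k, hk⟩ : ∃ k, n.factorization p = k + 1 :=
      Nat.exists_eq_succ_of_ne_zero (Finsupp.mem_support_iff.mp hp)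
    rw [hk, eG_prime_pow T hp', abs_le]
    have := eF_mem T (p ^ (k + 1))
    have := eF_mem T (p ^ k)
    constructor <;> linarith

lemma eG_support (T : ℕ → Set ℕ) (h1 : ∀ p, p.Prime → 1 ∈ T p) (n : ℕ) (hn : n ≠ 0)
    (h : eG T n ≠ 0) : ∃ a c : ℕ, n = a ^ 3 * c ^ 2 := by
  obtain ⟨a, b, hab, hsq⟩ := Nat.sq_mul_squarefree n
  have ha : a ≠ 0 := hsq.ne_zero
  have hb : b ≠ 0 := by rintro rfl; simp at hab; exact hn hab.symm
  have hdvd : a ∣ b := by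
    rw [← Nat.factorization_le_iff_dvd ha hb]
    intro p
    by_contra hlt
    have hle := hsq.natFactorization_le_one p
    have hf : n.factorization p = 1 := by
      rw [← hab, Nat.factorization_mul (pow_ne_zero 2 hb) ha, Nat.factorization_pow]
      simp only [Finsupp.add_apply, Finsupp.smul_apply, smul_eq_mul]
      omega
    have hmem : p ∈ n.factorization.support := by
      rw [Finsupp.mem_support_iff, hf]; exact one_ne_zero
    have hp : p.Prime := Nat.prime_of_mem_primeFactors (by simpa using hmem)
    apply h
    rw [(eG_mult T).multiplicative_factorization _ hn, Finsupp.prod]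
    apply Finset.prod_eq_zero hmem
    rw [hf]
    exact eG_prime T hp (h1 p hp)
  obtain ⟨c, rfl⟩ := hdvd
  exact ⟨a, c, by rw [← hab]; ring⟩

lemma eG_summable (T : ℕ → Set ℕ) (h1 : ∀ p, p.Prime → 1 ∈ T p) :
    Summable (fun n : ℕ => |eG T n| / n) := by
  have hs : Summable (fun x : ℕ × ℕ => (1 / (x.1 : ℝ) ^ 3) * (1 / (x.2 : ℝ) ^ 2)) := by
    apply Summable.mul_of_nonneg (f := fun x : ℕ => 1 / (x : ℝ) ^ 3) (g := fun x : ℕ => 1 / (x : ℝ) ^ 2)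
    · exact Real.summable_one_div_nat_pow.mpr (by norm_num)
    · exact Real.summable_one_div_nat_pow.mpr (by norm_num)
    · intro x; positivity
    · intro x; positivity
  choose! a c hac using eG_support T h1
  have key : Summable ((fun n : ℕ => |eG T n| / n) ∘
      ((↑) : {n : ℕ | n ≠ 0 ∧ eG T n ≠ 0} → ℕ)) := by
    have hinj : Function.Injective
        (fun n : {n : ℕ | n ≠ 0 ∧ eG T n ≠ 0} => (a n, c n)) := by
      intro x y hxy
      simp only [Prod.mk.injEq] at hxy
      apply Subtype.ext
      rw [hac x x.2.1 x.2.2, hac y y.2.1 y.2.2, hxy.1, hxy.2]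
    refine Summable.of_nonneg_of_le (fun _ => by simp only [Function.comp]; positivity) ?_
      (hs.comp_injective hinj)
    rintro ⟨n, hn⟩
    simp only [Function.comp]
    have := hac n hn.1 hn.2
    calc |eG T n| / n ≤ 1 / n := by gcongr; exact eG_abs_le T n
      _ = _ := by
        conv_lhs => rw [this]
        push_cast
        rw [div_mul_div_comm, one_mul]
  rw [summable_subtype_iff_indicator] at key
  convert key using 1
  ext n
  rw [Set.indicator_apply]
  split_ifs with h
  · rfl
  · simp only [Set.mem_ofPred_eq, not_and_or, not_not] at h
    rcases h with h | h <;> simp [h]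

lemma eF_density (T : ℕ → Set ℕ) (h1 : ∀ p, p.Prime → 1 ∈ T p) :
    Filter.Tendsto (fun N : ℕ => (∑ n ∈ Finset.Ioc 0 N, eF T n) / N) Filter.atTop
      (nhds (∑' n : ℕ, eG T n / n)) := by
  have e : ∀ N : ℕ, (∑ n ∈ Finset.Ioc 0 N, eF T n) / N =
      ∑' d : ℕ, eG T d * ((N / d : ℕ) : ℝ) / N := by
    intro N
    conv_lhs => rw [← eG_mul_zeta T]
    rw [ArithmeticFunction.sum_Ioc_mul_zeta_eq_sum, Finset.sum_div,
      tsum_eq_sum (s := Finset.Ioc 0 N)]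
    intro d hd
    have : N / d = 0 := by
      rcases Nat.eq_zero_or_pos d with rfl | h
      · simp
      · apply Nat.div_eq_of_lt; simp at hd; exact hd h
    simp [this]
  simp_rw [e]
  apply tendsto_tsum_of_dominated_convergence (eG_summable T h1)
  · intro d
    simp_rw [mul_div_assoc, div_eq_mul_inv (eG T d)]
    apply Filter.Tendsto.const_mul
    have := (tendsto_nat_floor_mul_div_atTop (R := ℝ) (a := (d : ℝ)⁻¹) (by positivity)).comp
      tendsto_natCast_atTop_atTop
    refine this.congr fun N => ?_
    simp only [Function.comp]
    rw [inv_mul_eq_div, Nat.floor_div_eq_div]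
  · filter_upwards [Filter.eventually_gt_atTop 0] with N hN d
    rw [Real.norm_eq_abs, abs_div, abs_mul, Nat.abs_cast, Nat.abs_cast, mul_div_assoc,
      div_eq_mul_inv |eG T d|]
    gcongr
    rw [div_le_iff₀ (by exact_mod_cast hN), inv_mul_eq_div]
    exact Nat.cast_div_le

lemma eG_euler (T : ℕ → Set ℕ) (h1 : ∀ p, p.Prime → 1 ∈ T p) :
    HasProd (fun p : Nat.Primes => 1 + ∑' i : ℕ,
      ((T p).indicator (fun _ => (1 : ℝ)) (i + 2) - (T p).indicator (fun _ => (1 : ℝ)) (i + 1)) /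
        ((p : ℕ) : ℝ) ^ (i + 2)) (∑' n : ℕ, eG T n / n) := by
  have hs : Summable (fun n : ℕ => ‖eG T n / n‖) := by
    simpa [abs_div] using eG_summable T h1
  have := EulerProduct.eulerProduct_hasProd (f := fun n : ℕ => eG T n / n)
    (by simp [(eG_mult T).map_one])
    (by
      intro m n hmn
      simp only [(eG_mult T).map_mul_of_coprime hmn, Nat.cast_mul]
      rw [mul_div_mul_comm]) hs (by simp)
  refine Eq.subst (motive := fun F => HasProd F _) (funext fun p => ?_) this
  symm
  have hp := p.2
  have hsp : Summable (fun e : ℕ => eG T ((p : ℕ) ^ e) / ((p ^ e : ℕ) : ℝ)) :=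
    hs.of_norm.comp_injective (Nat.pow_right_injective hp.two_le)
  rw [← hsp.sum_add_tsum_nat_add 2]
  simp only [Finset.sum_range_succ, Finset.sum_range_zero, eG_prime T hp (h1 p hp)]
  simp only [pow_zero, (eG_mult T).map_one, Nat.cast_one, zero_div, add_zero, div_one, zero_add]
  congr 1
  apply tsum_congr
  intro i
  rw [eG_prime_pow T hp (i + 1), eF_prime_pow T hp, eF_prime_pow T hp]
  push_cast
  rfl

noncomputable def primeEquiv : ℕ ≃ Nat.Primes :=
  Equiv.ofBijective (fun n => ⟨Nat.nth Nat.Prime n, Nat.prime_nth_prime n⟩) (by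
    constructor
    · intro x y h
      exact Nat.nth_injective Nat.infinite_setOfPred_prime (congrArg Subtype.val h)
    · rintro ⟨p, hp⟩
      exact ⟨Nat.count Nat.Prime p, Subtype.ext (Nat.nth_count hp)⟩)

theorem stmt_16 (Sseq : ℕ → Set ℕ) (h1 : ∀ n, 1 ≤ n → 1 ∈ Sseq n)
    (u : ℕ → ℕ → ℝ)
    (hu : ∀ n k, u n k = Set.indicator (Sseq n) (fun _ => (1 : ℝ)) k) :
    HasDensity {N : ℕ | IsExpANumber Sseq N}
      (∏' n : ℕ,
        (1 + ∑' i : ℕ, (u (n + 1) (i + 2) - u (n + 1) (i + 1)) /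
            (nthPrime (n + 1) : ℝ) ^ (i + 2))) := by
  classical
  set T : ℕ → Set ℕ := fun p => Sseq (Nat.count Nat.Prime p + 1) with hT
  have hT1 : ∀ p, p.Prime → 1 ∈ T p := fun p _ => h1 _ (by omega)
  have hTn : ∀ n, T (Nat.nth Nat.Prime n) = Sseq (n + 1) := fun n => by
    simp only [hT, Nat.count_nth_of_infinite Nat.infinite_setOfPred_prime]
  have hE := (primeEquiv.hasProd_iff).mpr (eG_euler T hT1)
  have hprod : (∏' n : ℕ, (1 + ∑' i : ℕ, (u (n + 1) (i + 2) - u (n + 1) (i + 1)) /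
            (nthPrime (n + 1) : ℝ) ^ (i + 2))) = ∑' n : ℕ, eG T n / n := by
    rw [← hE.tprod_eq]
    apply tprod_congr
    intro n
    have hv : ((primeEquiv n : Nat.Primes) : ℕ) = Nat.nth Nat.Prime n := rfl
    simp only [Function.comp, hv, hTn, hu, nthPrime,
      Nat.add_sub_cancel]
  rw [hprod]
  refine (eF_density T hT1).congr fun N => ?_
  congr 1
  have hiff : ∀ n, IsExpANumber Sseq n ↔
      (0 < n ∧ ∀ p, p.Prime → p ∣ n → n.factorization p ∈ T p) := by
    intro n
    refine and_congr_right fun _ => ⟨fun h p hp hd => ?_, fun h k hk hd => ?_⟩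
    · have := h (Nat.count Nat.Prime p + 1) (by omega)
      simp only [nthPrime, Nat.add_sub_cancel, Nat.nth_count hp] at this
      exact this hd
    · have := h _ (Nat.prime_nth_prime (k - 1)) hd
      rw [hTn, Nat.sub_add_cancel hk] at this
      exact this
  have hset : {n : ℕ | n ∈ {N : ℕ | IsExpANumber Sseq N} ∧ n ≤ N} =
      ↑((Finset.Ioc 0 N).filter (fun n => 0 < n ∧ ∀ p, p.Prime → p ∣ n → n.factorization p ∈ T p)) := by
    ext n
    simp only [Set.mem_ofPred_eq, hiff, Finset.coe_filter, Finset.mem_Ioc]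
    tauto
  rw [hset, Set.ncard_coe_finset]
  simp_rw [eF_apply]
  rw [Finset.sum_boole]
end
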